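/- arXiv:1504.00660 — 2 statements merged into one kernel-verified Lean document; each statement's English description precedes it below -/
import Mathlib

section
/- Let q : [0,1] → ℝ be continuous, nonpositive (q(x) ≤ 0 on [0,1]) and single-barrier, and let ℓ₀ ∈ (0,1] be such that the eigenvalues λ₁(ℓ₀) < λ₂(ℓ₀) < ⋯ of the Dirichlet problem −y'' + q(x) y = λ y on [0,ℓ₀], y(0) = y(ℓ₀) = 0, satisfy λ₁(ℓ₀) > 0 and λ_n(ℓ₀)/λ_m(ℓ₀) ≥ n²/m² for all n > m ≥ 1. If for two different indices n ≠ m equality λ_n(ℓ₀) / λ_m(ℓ₀) = n² / m² holds, then q ≡ 0 on [0,ℓ₀] (and conversely, if q ≡ 0 on [0,ℓ₀] then λ_n(ℓ₀) / λ_m(ℓ₀) = n² / m² for all n, m). -/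
/-- `lam` is an eigenvalue of the Dirichlet problem `−y'' + q y = λ y` on `[a, b]`,
`y a = y b = 0`: there is a nontrivial solution (with derivative `y'` and
`y'' = (q − λ) y` on `[a, b]`) satisfying the boundary conditions. -/
def IsDirichletEigenvalue (q : ℝ → ℝ) (a b lam : ℝ) : Prop :=
  ∃ y y' : ℝ → ℝ,
    (∀ x ∈ Set.Icc a b, HasDerivAt y (y' x) x) ∧
    (∀ x ∈ Set.Icc a b, HasDerivAt y' ((q x - lam) * y x) x) ∧
    (∃ x ∈ Set.Icc a b, y x ≠ 0) ∧
    y a = 0 ∧ y b = 0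

open Real Set Filter Topology

/-- Cusa's inequality. -/
theorem three_mul_sin_lt {w : ℝ} (hw : 0 < w) : 3 * sin w < w * (2 + cos w) := by
  rcases le_or_gt π w with hπ | hπ
  · have h1 := sin_le_one w
    have h2 := neg_one_le_cos w
    have h3 := pi_gt_three
    nlinarith
  have hpos : ∀ x ∈ Ioo 0 π, 0 < sin x - x * cos x := by
    intro x hx
    by_cases hc : x < π / 2
    · have := lt_tan hx.1 hc
      have hcp : 0 < cos x := cos_pos_of_mem_Ioo ⟨by linarith [hx.1], hc⟩
      rw [tan_eq_sin_div_cos, lt_div_iff₀ hcp] at this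
      linarith
    · have h1 : cos x ≤ 0 :=
        cos_nonpos_of_pi_div_two_le_of_le (not_lt.1 hc) (by linarith [hx.2, pi_pos])
      nlinarith [sin_pos_of_mem_Ioo hx, hx.1]
  have hmono : StrictMonoOn (fun x : ℝ => 2 - 2 * cos x - x * sin x) (Icc 0 π) := by
    refine strictMonoOn_of_hasDerivWithinAt_pos (f' := fun x => sin x - x * cos x)
      (convex_Icc _ _) (by fun_prop) (fun x _ => ?_) (fun x hx => ?_)
    · have := ((hasDerivAt_cos x).const_mul 2).const_sub 2 |>.sub
        ((hasDerivAt_id x).mul (hasDerivAt_sin x))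
      refine (this.congr_deriv ?_).hasDerivWithinAt
      simp; ring
    · rw [interior_Icc] at hx; exact hpos x hx
  have hmono' : StrictMonoOn (fun x : ℝ => x * (2 + cos x) - 3 * sin x) (Icc 0 π) := by
    refine strictMonoOn_of_hasDerivWithinAt_pos (f' := fun x => 2 - 2 * cos x - x * sin x)
      (convex_Icc _ _) (by fun_prop) (fun x _ => ?_) (fun x hx => ?_)
    · have := ((hasDerivAt_id x).mul ((hasDerivAt_cos x).const_add 2)).sub
        ((hasDerivAt_sin x).const_mul 3)
      refine (this.congr_deriv ?_).hasDerivWithinAt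
      simp; ring
    · rw [interior_Icc] at hx
      simpa using hmono ⟨le_rfl, pi_pos.le⟩ (Ioo_subset_Icc_self hx) hx.1
  simpa using hmono' ⟨le_rfl, pi_pos.le⟩ ⟨hw.le, hπ.le⟩ hw

theorem monotone_sub_sin : Monotone fun w : ℝ => w - sin w := fun x y hxy => by
  have h := le_of_abs_le (abs_sin_sub_sin_le y x)
  rw [abs_of_nonneg (sub_nonneg.2 hxy)] at h
  dsimp only
  linarith

theorem strictAntiOn_sub_sin_div_cube :
    StrictAntiOn (fun w : ℝ => (w - sin w) / w ^ 3) (Ioi 0) := by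
  have hd : ∀ w ∈ Ioi (0 : ℝ), HasDerivAt (fun w : ℝ => (w - sin w) / w ^ 3)
      (((1 - cos w) * w ^ 3 - (w - sin w) * (3 * w ^ 2)) / (w ^ 3) ^ 2) w := fun w hw =>
    (((hasDerivAt_id w).sub (hasDerivAt_sin w)).fun_div (hasDerivAt_pow 3 w)
      (pow_ne_zero 3 (ne_of_gt hw))).congr_deriv (by simp)
  refine strictAntiOn_of_deriv_neg (convex_Ioi 0)
    (fun w hw => (hd w hw).continuousAt.continuousWithinAt) fun w hw => ?_
  rw [interior_Ioi] at hw
  rw [(hd w hw).deriv]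
  have hw' : 0 < w := hw
  refine div_neg_of_neg_of_pos ?_ (by positivity)
  have := three_mul_sin_lt hw'
  have h2 : 0 < w ^ 2 := by positivity
  nlinarith

/-- The integral `∫₀^τ sin² (ω s) / ω² ds`, in closed form, increases with `τ` and decreases
with `ω`. -/
theorem sub_sin_div_lt {ω₁ ω₂ τ₁ τ₂ : ℝ} (h₁ : 0 < ω₁) (h₁₂ : ω₁ < ω₂) (hτ₁ : 0 < τ₁)
    (hτ : τ₂ ≤ τ₁) :
    (2 * (ω₂ * τ₂) - sin (2 * (ω₂ * τ₂))) / (4 * ω₂ ^ 3) <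
      (2 * (ω₁ * τ₁) - sin (2 * (ω₁ * τ₁))) / (4 * ω₁ ^ 3) := by
  have h₂ : 0 < ω₂ := h₁.trans h₁₂
  have hle : 2 * (ω₂ * τ₂) - sin (2 * (ω₂ * τ₂)) ≤ 2 * (ω₂ * τ₁) - sin (2 * (ω₂ * τ₁)) :=
    monotone_sub_sin (by gcongr)
  have hlt := strictAntiOn_sub_sin_div_cube (a := 2 * (ω₁ * τ₁)) (b := 2 * (ω₂ * τ₁))
    (mem_Ioi.2 (by positivity)) (mem_Ioi.2 (by positivity)) (by gcongr)
  have hscale : ∀ ω S : ℝ, 0 < ω → S / (4 * ω ^ 3) = 2 * τ₁ ^ 3 * (S / (2 * (ω * τ₁)) ^ 3) := by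
    intro ω S hω
    field_simp
    norm_num
  calc _ ≤ (2 * (ω₂ * τ₁) - sin (2 * (ω₂ * τ₁))) / (4 * ω₂ ^ 3) := by gcongr
    _ < _ := by
      rw [hscale _ _ h₁, hscale _ _ h₂]
      gcongr

noncomputable def tau (z φ P : ℝ) : ℝ :=
  (φ + arctan ((√(z ^ 2 + P) - z) * (sin φ * cos φ) /
    (z * cos φ ^ 2 + √(z ^ 2 + P) * sin φ ^ 2))) / √(z ^ 2 + P)

noncomputable def tauRate (z φ P : ℝ) : ℝ :=
  (2 * (√(z ^ 2 + P) * tau z φ P) - sin (2 * (√(z ^ 2 + P) * tau z φ P))) / (4 * √(z ^ 2 + P) ^ 3)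

theorem den_pos {z ω : ℝ} (hz : 0 < z) (hω : 0 < ω) (φ : ℝ) :
    0 < z * cos φ ^ 2 + ω * sin φ ^ 2 := by
  have h := sin_sq_add_cos_sq φ
  by_cases hs : sin φ = 0
  · have : cos φ ^ 2 = 1 := by rw [hs] at h; linarith
    rw [this, hs]; simpa using hz
  · have := mul_pos hω (pow_pos (abs_pos.2 hs) 2)
    rw [sq_abs] at this
    positivity

theorem hasDerivAt_tau_phase {z P : ℝ} (hz : 0 < z) (hP : 0 ≤ P) (φ : ℝ) :
    HasDerivAt (fun φ => tau z φ P) (z / (z ^ 2 + P * sin φ ^ 2)) φ := by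
  unfold tau
  have hsq : √(z ^ 2 + P) ^ 2 = z ^ 2 + P := sq_sqrt (by positivity)
  have hω : 0 < √(z ^ 2 + P) := sqrt_pos.2 (by positivity)
  generalize √(z ^ 2 + P) = ω at *
  have hd := den_pos hz hω φ
  have h1 : HasDerivAt (fun φ => (ω - z) * (sin φ * cos φ))
      ((ω - z) * (cos φ ^ 2 - sin φ ^ 2)) φ :=
    (((hasDerivAt_sin φ).mul (hasDerivAt_cos φ)).const_mul (ω - z)).congr_deriv (by ring)
  have h2 : HasDerivAt (fun φ => z * cos φ ^ 2 + ω * sin φ ^ 2)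
      (2 * (ω - z) * (sin φ * cos φ)) φ :=
    ((((hasDerivAt_cos φ).pow 2).const_mul z).add
      (((hasDerivAt_sin φ).pow 2).const_mul ω)).congr_deriv (by simp; ring)
  refine (((hasDerivAt_id φ).add (h1.fun_div h2 hd.ne').arctan).div_const ω).congr_deriv ?_
  have hP' : P = ω ^ 2 - z ^ 2 := by linarith
  have hc : cos φ ^ 2 = 1 - sin φ ^ 2 := cos_sq' φ
  have hnum : ∀ s c d : ℝ, 0 < d → d = z * c ^ 2 + ω * s ^ 2 → c ^ 2 = 1 - s ^ 2 →
      (1 + 1 / (1 + ((ω - z) * (s * c) / d) ^ 2) *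
      (((ω - z) * (c ^ 2 - s ^ 2) * d - (ω - z) * (s * c) * (2 * (ω - z) * (s * c))) / d ^ 2)) / ω
      = z / (z ^ 2 + (ω ^ 2 - z ^ 2) * s ^ 2) := by
    intro s c d hd hdd hc
    have hE : z ^ 2 + (ω ^ 2 - z ^ 2) * s ^ 2 = d ^ 2 + ((ω - z) * (s * c)) ^ 2 := by
      rw [hdd]
      have : ((ω - z) * (s * c)) ^ 2 = (ω - z) ^ 2 * s ^ 2 * c ^ 2 := by ring
      rw [this, hc]; ring
    rw [hE]
    have hEp : 0 < d ^ 2 + ((ω - z) * (s * c)) ^ 2 := by positivity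
    field_simp
    have h3 : (ω - z) ^ 2 * s ^ 2 * c ^ 2 = (ω - z) ^ 2 * s ^ 2 * (1 - s ^ 2) := by rw [hc]
    have h4 : d = z * (1 - s ^ 2) + ω * s ^ 2 := by rw [hdd, hc]
    simp only [mul_pow] at *
    rw [hc, h4]; ring
  rw [hP']
  exact hnum _ _ _ hd rfl hc

theorem hasDerivAt_tau_potential {z P : ℝ} (hz : 0 < z) (hP : 0 ≤ P) (φ : ℝ) :
    HasDerivAt (fun P => tau z φ P) (-tauRate z φ P) P := by
  have hpos : 0 < z ^ 2 + P := by positivity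
  have hω : 0 < √(z ^ 2 + P) := sqrt_pos.2 hpos
  have h0 : HasDerivAt (fun P => √(z ^ 2 + P)) (1 / (2 * √(z ^ 2 + P))) P :=
    ((hasDerivAt_id P).const_add (z ^ 2)).sqrt hpos.ne'
  have hT : √(z ^ 2 + P) * tau z φ P = φ + arctan ((√(z ^ 2 + P) - z) * (sin φ * cos φ) /
    (z * cos φ ^ 2 + √(z ^ 2 + P) * sin φ ^ 2)) := by
    unfold tau; field_simp
  have hd := den_pos hz hω φ
  have h1 := ((h0.sub_const z).mul_const (sin φ * cos φ)).fun_div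
    ((h0.mul_const (sin φ ^ 2)).const_add (z * cos φ ^ 2)) hd.ne'
  have h2 := (h1.arctan.const_add φ).fun_div h0 hω.ne'
  unfold tauRate
  rw [hT]
  refine h2.congr_deriv ?_
  generalize √(z ^ 2 + P) = ω at *
  have hc : cos φ ^ 2 = 1 - sin φ ^ 2 := cos_sq' φ
  rw [mul_add 2 φ, sin_add, sin_two_mul (arctan _), cos_two_mul (arctan _), cos_sq_arctan,
    mul_assoc 2 (sin (arctan _)), show ∀ x : ℝ, sin (arctan x) * cos (arctan x) = x / (1 + x ^ 2) by
      intro x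
      rw [sin_arctan, cos_arctan, div_mul_div_comm, mul_one, mul_self_sqrt (by positivity)],
    sin_two_mul, cos_two_mul, hc]
  generalize sin φ = s at *
  generalize cos φ = c at *
  rw [hc] at hd
  set d := z * (1 - s ^ 2) + ω * s ^ 2 with hdd
  generalize arctan ((ω - z) * (s * c) / d) = α
  have hE : 0 < d ^ 2 + ((ω - z) * (s * c)) ^ 2 := by positivity
  field_simp
  simp only [mul_pow] at *
  rw [hc, hdd]
  ring

theorem continuousAt_tau {z P : ℝ} (hz : 0 < z) (hP : 0 ≤ P) (φ : ℝ) :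
    ContinuousAt (fun w : ℝ × ℝ => tau z w.1 w.2) (φ, P) := by
  have hω : 0 < √(z ^ 2 + P) := sqrt_pos.2 (by positivity)
  have hd := den_pos hz hω φ
  unfold tau
  refine ContinuousAt.div (ContinuousAt.add (by fun_prop) (continuous_arctan.continuousAt.comp
    (ContinuousAt.div (by fun_prop) (by fun_prop) hd.ne'))) (by fun_prop) hω.ne'

theorem continuousAt_tauRate {z P : ℝ} (hz : 0 < z) (hP : 0 ≤ P) (φ : ℝ) :
    ContinuousAt (fun w : ℝ × ℝ => tauRate z w.1 w.2) (φ, P) := by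
  have hω : 0 < √(z ^ 2 + P) := sqrt_pos.2 (by positivity)
  have ht := continuousAt_tau hz hP φ
  unfold tauRate
  have h4 : 4 * √(z ^ 2 + P) ^ 3 ≠ 0 := by positivity
  exact ContinuousAt.div (by fun_prop) (by fun_prop) h4

theorem tau_potential_zero {z : ℝ} (hz : 0 < z) (φ : ℝ) : tau z φ 0 = φ / z := by
  simp [tau, sqrt_sq hz.le]

theorem tau_zero (z P : ℝ) : tau z 0 P = 0 := by simp [tau]

theorem tau_pos {z P φ : ℝ} (hz : 0 < z) (hP : 0 ≤ P) (hφ : 0 < φ) : 0 < tau z φ P := by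
  have hmono : StrictMono fun φ => tau z φ P := strictMono_of_deriv_pos fun φ => by
    rw [(hasDerivAt_tau_phase hz hP φ).deriv]; positivity
  simpa [tau_zero] using hmono hφ

theorem tauRate_lt {z₁ z₂ φ₁ φ₂ P : ℝ} (h₁ : 0 < z₁) (h₁₂ : z₁ < z₂) (hP : 0 ≤ P)
    (hφ₁ : 0 < φ₁) (h : tau z₂ φ₂ P ≤ tau z₁ φ₁ P) :
    tauRate z₂ φ₂ P < tauRate z₁ φ₁ P :=
  sub_sin_div_lt (sqrt_pos.2 (by positivity)) (sqrt_lt_sqrt (by positivity) (by gcongr))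
    (tau_pos h₁ hP hφ₁) h

/-- A continuous function whose lower right derivatives are nonnegative as long as it stays above
`g b - ρ` never falls below `g b`. -/
theorem le_of_eventually_sub_mul_le {g : ℝ → ℝ} {b c ρ : ℝ} (hρ : 0 < ρ)
    (hg : ContinuousOn g (Icc b c))
    (h : ∀ x ∈ Ico b c, g b - ρ < g x → ∀ ε > 0, ∀ᶠ y in 𝓝[>] x, g x - ε * (y - x) ≤ g y) :
    ∀ x ∈ Icc b c, g b ≤ g x := by
  intro x hx
  have key : ∀ ε > 0, ε * (c - b) < ρ → g b - ε * (x - b) ≤ g x := by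
    intro ε hε hερ
    have hsub : Icc b c ⊆ {x | g b - ε * (x - b) ≤ g x} := by
      refine IsClosed.Icc_subset_of_forall_mem_nhdsWithin ?_ (by simp) ?_
      · rw [inter_comm]
        exact isClosed_Icc.isClosed_le (f := fun x => g b - ε * (x - b)) (by fun_prop) hg
      · rintro y ⟨hy, hyI⟩
        have hy' : g b - ε * (y - b) ≤ g y := hy
        have hlt : ε * (y - b) ≤ ε * (c - b) := by
          have := hyI.2.le
          gcongr
        filter_upwards [h y hyI (by linarith) ε hε] with w hw
        linarith
    exact hsub hx
  have hlim : Tendsto (fun ε : ℝ => g b - ε * (x - b)) (𝓝[>] 0) (𝓝 (g b)) := by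
    refine (Continuous.tendsto' (by fun_prop) 0 (g b) (by simp)).mono_left nhdsWithin_le_nhds
  have hsmall : ∀ᶠ ε in 𝓝[>] (0 : ℝ), ε * (c - b) < ρ := by
    have : Tendsto (fun ε : ℝ => ε * (c - b)) (𝓝[>] 0) (𝓝 0) :=
      (Continuous.tendsto' (by fun_prop) 0 0 (by simp)).mono_left nhdsWithin_le_nhds
    exact this.eventually_lt_const hρ
  refine le_of_tendsto hlim ?_
  filter_upwards [hsmall, self_mem_nhdsWithin] with ε h1 h2
  exact key ε h2 h1

theorem HasDerivAt.eventually_sub_mul_le {f : ℝ → ℝ} {f' x ε : ℝ} (h : HasDerivAt f f' x)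
    (h_nonneg : 0 ≤ f') (hε : 0 < ε) : ∀ᶠ y in 𝓝[>] x, f x - ε * (y - x) ≤ f y := by
  have h1 := (hasDerivAt_iff_isLittleO.1 h).def hε
  filter_upwards [h1.filter_mono nhdsWithin_le_nhds, self_mem_nhdsWithin] with y hy hxy
  have hxy' : 0 < y - x := sub_pos.2 hxy
  rw [norm_eq_abs, norm_eq_abs, abs_of_pos hxy', smul_eq_mul] at hy
  have := neg_le_of_abs_le hy
  nlinarith [mul_nonneg hxy'.le h_nonneg]

theorem hasDerivAt_tau_comp {z P x : ℝ} {φ : ℝ → ℝ} (hz : 0 < z) (hP : 0 ≤ P)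
    (hφ : HasDerivAt φ (z + P / z * sin (φ x) ^ 2) x) :
    HasDerivAt (fun y => tau z (φ y) P) 1 x := by
  refine ((hasDerivAt_tau_phase hz hP (φ x)).comp x hφ).congr_deriv ?_
  have : 0 < z ^ 2 + P * sin (φ x) ^ 2 := by positivity
  field_simp

theorem eventually_tau_sub_tau_le {z₁ z₂ η x c : ℝ} {p φ₁ φ₂ : ℝ → ℝ} (hz₁ : 0 < z₁)
    (hz₂ : 0 < z₂) (hxc : x < c) (hp : Continuous p) (hp_anti : AntitoneOn p (Icc x c))
    (hp_nonneg : ∀ y ∈ Icc x c, 0 ≤ p y)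
    (hφ₁ : HasDerivAt φ₁ (z₁ + p x / z₁ * sin (φ₁ x) ^ 2) x)
    (hφ₂ : HasDerivAt φ₂ (z₂ + p x / z₂ * sin (φ₂ x) ^ 2) x)
    (hη : tauRate z₂ (φ₂ x) (p x) + η < tauRate z₁ (φ₁ x) (p x)) {ε : ℝ} (hε : 0 < ε) :
    ∀ᶠ y in 𝓝[>] x,
      tau z₁ (φ₁ x) (p x) - tau z₂ (φ₂ x) (p x) + η * p x - ε * (y - x) ≤
        tau z₁ (φ₁ y) (p y) - tau z₂ (φ₂ y) (p y) + η * p y := by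
  have hxI : x ∈ Icc x c := ⟨le_rfl, hxc.le⟩
  have hpx := hp_nonneg x hxI
  have hfrozen := (((hasDerivAt_tau_comp hz₁ hpx hφ₁).sub
    (hasDerivAt_tau_comp hz₂ hpx hφ₂)).add_const (η * p x)).eventually_sub_mul_le
    (by norm_num) hε
  have hcont : ContinuousAt (fun w : ℝ × ℝ =>
      tauRate z₂ (φ₂ w.1) w.2 + η - tauRate z₁ (φ₁ w.1) w.2) (x, p x) := by
    have h1 : ContinuousAt (fun w : ℝ × ℝ => tauRate z₁ (φ₁ w.1) w.2) (x, p x) :=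
      ContinuousAt.comp (f := fun w : ℝ × ℝ => (φ₁ w.1, w.2)) (x := (x, p x))
        (continuousAt_tauRate hz₁ hpx (φ₁ x))
        ((hφ₁.continuousAt.comp continuousAt_fst).prodMk continuousAt_snd)
    have h2 : ContinuousAt (fun w : ℝ × ℝ => tauRate z₂ (φ₂ w.1) w.2) (x, p x) :=
      ContinuousAt.comp (f := fun w : ℝ × ℝ => (φ₂ w.1, w.2)) (x := (x, p x))
        (continuousAt_tauRate hz₂ hpx (φ₂ x))
        ((hφ₂.continuousAt.comp continuousAt_fst).prodMk continuousAt_snd)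
    exact (h2.add continuousAt_const).sub h1
  have hneg := hcont.eventually_lt_const (u := 0) (by simpa using sub_neg.2 hη)
  obtain ⟨r, hr, hball⟩ := Metric.eventually_nhds_iff.1 hneg
  have hy_near : ∀ᶠ y in 𝓝[>] x, dist y x < r :=
    nhdsWithin_le_nhds (Metric.ball_mem_nhds x hr)
  have hp_near : ∀ᶠ y in 𝓝[>] x, dist (p y) (p x) < r :=
    (hp.continuousAt.tendsto.eventually (Metric.ball_mem_nhds (p x) hr)).filter_mono
      nhdsWithin_le_nhds
  filter_upwards [hfrozen, hy_near, hp_near, Ioo_mem_nhdsGT hxc] with y hy hyr hpr hyI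
  have hyI' : y ∈ Icc x c := Ioo_subset_Icc_self hyI
  have hle : p y ≤ p x := hp_anti hxI hyI' hyI.1.le
  have hpy := hp_nonneg y hyI'
  have hd : ∀ P ∈ Icc (p y) (p x), HasDerivAt
      (fun P => tau z₁ (φ₁ y) P - tau z₂ (φ₂ y) P + η * P)
      (-tauRate z₁ (φ₁ y) P - -tauRate z₂ (φ₂ y) P + η) P := fun P hP =>
    ((((hasDerivAt_tau_potential hz₁ (hpy.trans hP.1) _).sub
      (hasDerivAt_tau_potential hz₂ (hpy.trans hP.1) _)).add
      ((hasDerivAt_id P).const_mul η))).congr_deriv (by simp)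
  have hanti : AntitoneOn (fun P => tau z₁ (φ₁ y) P - tau z₂ (φ₂ y) P + η * P)
      (Icc (p y) (p x)) := by
    refine antitoneOn_of_hasDerivWithinAt_nonpos (convex_Icc _ _)
      (fun P hP => (hd P hP).continuousAt.continuousWithinAt)
      (fun P hP => (hd P (interior_subset hP)).hasDerivWithinAt) (fun P hP => ?_)
    have hP' := interior_subset hP
    have hPr : dist P (p x) < r := by
      rw [dist_eq, abs_lt] at hpr ⊢
      constructor <;> linarith [hP'.1, hP'.2]
    have := hball (y := (y, P)) (by rw [Prod.dist_eq]; exact max_lt hyr hPr)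
    simp only at this
    linarith
  have := hanti ⟨le_rfl, hle⟩ ⟨hle, le_rfl⟩ hle
  exact hy.trans this

theorem lipschitzWith_add_mul_sin_sq {A B : ℝ} {K : NNReal} (hB : |B| ≤ K) :
    LipschitzWith K fun φ : ℝ => A + B * sin φ ^ 2 := by
  refine LipschitzWith.of_dist_le_mul fun x y => ?_
  have h : A + B * sin x ^ 2 - (A + B * sin y ^ 2) = B * (sin (x - y) * sin (x + y)) := by
    rw [sin_sub, sin_add]
    have hx := sin_sq_add_cos_sq x
    have hy := sin_sq_add_cos_sq y
    linear_combination B * (sin y ^ 2 * hx - sin x ^ 2 * hy)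
  rw [dist_eq, dist_eq, h, abs_mul, abs_mul]
  have h1 : |sin (x - y)| ≤ |x - y| := abs_sin_le_abs
  have h2 := abs_sin_le_one (x + y)
  calc |B| * (|sin (x - y)| * |sin (x + y)|) ≤ K * (|x - y| * 1) := by gcongr
    _ = K * |x - y| := by ring

theorem exists_abs_le_of_continuous {B : ℝ → ℝ} (hB : Continuous B) (a b : ℝ) :
    ∃ K : NNReal, ∀ t ∈ Icc a b, |B t| ≤ K := by
  obtain ⟨C, hC⟩ := isCompact_Icc.exists_bound_of_continuousOn (s := Icc a b) hB.continuousOn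
  exact ⟨C.toNNReal, fun t ht => (hC t ht).trans (le_coe_toNNReal C)⟩

theorem exists_hasDerivAt_add_mul_sin_sq (A : ℝ) {B : ℝ → ℝ} (hB : Continuous B) (x₀ T : ℝ)
    (hT : 0 < T) :
    ∃ φ : ℝ → ℝ, φ 0 = x₀ ∧ ∀ t ∈ Ioo (-T) T, HasDerivAt φ (A + B t * sin (φ t) ^ 2) t := by
  obtain ⟨K, hK⟩ := exists_abs_le_of_continuous hB (-T) T
  have h0 : (0 : ℝ) ∈ Icc (-T) T := ⟨by linarith, hT.le⟩
  set L : NNReal := ‖A‖₊ + K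
  have hPL : IsPicardLindelof (fun t φ => A + B t * sin φ ^ 2) (⟨0, h0⟩ : Icc (-T) T) x₀
      (L * T.toNNReal) 0 L K := by
    refine ⟨fun t ht => (lipschitzWith_add_mul_sin_sq (hK t ht)).lipschitzOnWith,
      fun x _ => by fun_prop, fun t ht x _ => ?_, ?_⟩
    · have h1 := hK t ht
      have h2 : sin x ^ 2 ≤ 1 := sin_sq_le_one x
      calc ‖A + B t * sin x ^ 2‖ ≤ ‖A‖ + ‖B t * sin x ^ 2‖ := norm_add_le _ _
        _ = ‖A‖ + |B t| * sin x ^ 2 := by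
          rw [norm_mul, norm_of_nonneg (sq_nonneg (sin x)), norm_eq_abs (B t)]
        _ ≤ ‖A‖ + K * 1 := by gcongr
        _ = L := by simp [L]
    · simp [hT.le]
  obtain ⟨φ, hφ0, hφ⟩ := hPL.exists_eq_forall_mem_Icc_hasDerivWithinAt
    (Metric.mem_closedBall_self le_rfl)
  exact ⟨φ, hφ0, fun t ht =>
    (hφ t (Ioo_subset_Icc_self ht)).hasDerivAt (Icc_mem_nhds ht.1 ht.2)⟩

/-- The data of the comparison: `φ` is the phase of a solution with frequency `z` in a
potential `-p`. -/
def IsPhase (p : ℝ → ℝ) (a z : ℝ) (φ : ℝ → ℝ) : Prop :=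
  ∀ x ∈ Icc 0 a, HasDerivAt φ (z + p x / z * sin (φ x) ^ 2) x

theorem IsPhase.lt {p φ : ℝ → ℝ} {a z : ℝ} (h : IsPhase p a z φ) (hz : 0 < z)
    (hp : ∀ x ∈ Icc 0 a, 0 ≤ p x) {x : ℝ} (hx : x ∈ Ioc 0 a) : φ 0 < φ x := by
  have : StrictMonoOn φ (Icc 0 a) :=
    strictMonoOn_of_hasDerivWithinAt_pos (convex_Icc _ _)
      (fun x hx => (h x hx).continuousAt.continuousWithinAt)
      (fun x hx => (h x (interior_subset hx)).hasDerivWithinAt)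
      (fun x hx => by have := hp x (interior_subset hx); positivity)
  exact this ⟨le_rfl, hx.1.le.trans hx.2⟩ (Ioc_subset_Icc_self hx) hx.1

theorem IsPhase.continuousOn_tau {p φ : ℝ → ℝ} {a z : ℝ} (h : IsPhase p a z φ) (hz : 0 < z)
    (hpc : Continuous p) (hp : ∀ x ∈ Icc 0 a, 0 ≤ p x) :
    ContinuousOn (fun x => tau z (φ x) (p x)) (Icc 0 a) := fun x hx =>
  (ContinuousAt.comp (f := fun x => (φ x, p x)) (continuousAt_tau hz (hp x hx) (φ x))
    ((h x hx).continuousAt.prodMk hpc.continuousAt)).continuousWithinAt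

section Comparison

variable {p : ℝ → ℝ} {a z₁ z₂ : ℝ} {φ₁ φ₂ : ℝ → ℝ}

theorem tau_lt_tau_of_pos (hp : Continuous p) (ha : 0 ≤ a)
    (hp_anti : AntitoneOn p (Icc 0 a)) (hp_nonneg : ∀ x ∈ Icc 0 a, 0 ≤ p x) (hz₁ : 0 < z₁)
    (hz₁₂ : z₁ < z₂) (hφ₁ : IsPhase p a z₁ φ₁) (hφ₂ : IsPhase p a z₂ φ₂)
    (h₁ : 0 < φ₁ 0) (h₂ : φ₂ 0 = 0) :
    ∀ x ∈ Icc 0 a, ∀ P ∈ Icc 0 (p x), tau z₂ (φ₂ x) P < tau z₁ (φ₁ x) P := by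
  have hz₂ : 0 < z₂ := hz₁.trans hz₁₂
  have h0 : (0 : ℝ) ∈ Icc 0 a := ⟨le_rfl, ha⟩
  have hφ₁_pos : ∀ x ∈ Icc 0 a, 0 < φ₁ x := by
    intro x hx
    rcases hx.1.eq_or_lt with rfl | hx0
    · exact h₁
    · exact h₁.trans (hφ₁.lt hz₁ hp_nonneg ⟨hx0, hx.2⟩)
  have hstart : 0 < tau z₁ (φ₁ 0) (p 0) - tau z₂ (φ₂ 0) (p 0) := by
    rw [h₂, tau_zero, sub_zero]
    exact tau_pos hz₁ (hp_nonneg 0 h0) h₁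
  have hdiag : ∀ x ∈ Icc 0 a, tau z₂ (φ₂ x) (p x) < tau z₁ (φ₁ x) (p x) := by
    intro x hx
    have := le_of_eventually_sub_mul_le (g := fun x => tau z₁ (φ₁ x) (p x) - tau z₂ (φ₂ x) (p x))
      hstart ((hφ₁.continuousOn_tau hz₁ hp hp_nonneg).sub
        (hφ₂.continuousOn_tau hz₂ hp hp_nonneg)) (fun y hy hgy ε hε => ?_) x hx
    · linarith
    · have hyI := Ico_subset_Icc_self hy
      have hsub : Icc y a ⊆ Icc 0 a := Icc_subset_Icc_left hy.1
      have := eventually_tau_sub_tau_le (η := 0) hz₁ hz₂ hy.2 hp (hp_anti.mono hsub)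
        (fun w hw => hp_nonneg w (hsub hw)) (hφ₁ y hyI) (hφ₂ y hyI) (by
          rw [add_zero]
          exact tauRate_lt hz₁ hz₁₂ (hp_nonneg y hyI) (hφ₁_pos y hyI) (by linarith)) hε
      simpa using this
  intro x hx P hP
  have hd : ∀ u ∈ Icc 0 (p x), HasDerivAt
      (fun u => tau z₁ (φ₁ x) (p x - u) - tau z₂ (φ₂ x) (p x - u))
      (tauRate z₁ (φ₁ x) (p x - u) - tauRate z₂ (φ₂ x) (p x - u)) u := by
    intro u hu
    have hv : HasDerivAt (fun u => p x - u) (-1) u := (hasDerivAt_id u).const_sub (p x)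
    exact (((hasDerivAt_tau_potential hz₁ (sub_nonneg.2 hu.2) (φ₁ x)).comp u hv).sub
      ((hasDerivAt_tau_potential hz₂ (sub_nonneg.2 hu.2) (φ₂ x)).comp u hv)).congr_deriv (by ring)
  have := le_of_eventually_sub_mul_le (ρ := tau z₁ (φ₁ x) (p x) - tau z₂ (φ₂ x) (p x))
    (g := fun u => tau z₁ (φ₁ x) (p x - u) - tau z₂ (φ₂ x) (p x - u))
    (sub_pos.2 (hdiag x hx)) (fun u hu => (hd u hu).continuousAt.continuousWithinAt)
    (fun u hu hgu ε hε => (hd u (Ico_subset_Icc_self hu)).eventually_sub_mul_le (by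
      have := tauRate_lt hz₁ hz₁₂ (sub_nonneg.2 hu.2.le) (hφ₁_pos x hx)
        (by simp only [sub_zero] at hgu; linarith : tau z₂ (φ₂ x) (p x - u) ≤ _)
      linarith) hε) (p x - P) ⟨sub_nonneg.2 hP.2, by linarith [hP.1]⟩
  simp only [sub_zero, sub_sub_cancel] at this
  linarith [hdiag x hx]

theorem tau_le_tau (hp : Continuous p) (ha : 0 ≤ a)
    (hp_anti : AntitoneOn p (Icc 0 a)) (hp_nonneg : ∀ x ∈ Icc 0 a, 0 ≤ p x) (hz₁ : 0 < z₁)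
    (hz₁₂ : z₁ < z₂) (hφ₁ : IsPhase p a z₁ φ₁) (hφ₂ : IsPhase p a z₂ φ₂)
    (h₁ : φ₁ 0 = 0) (h₂ : φ₂ 0 = 0) :
    ∀ x ∈ Icc 0 a, ∀ P ∈ Icc 0 (p x), tau z₂ (φ₂ x) P ≤ tau z₁ (φ₁ x) P := by
  have hB : Continuous fun x => p x / z₁ := by fun_prop
  choose ψ hψ0 hψ using fun δ : ℝ =>
    exists_hasDerivAt_add_mul_sin_sq z₁ hB δ (a + 1) (by positivity)
  have hψ' : ∀ δ, IsPhase p a z₁ (ψ δ) := fun δ x hx =>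
    hψ δ x ⟨by linarith [hx.1], by linarith [hx.2]⟩
  obtain ⟨K, hK⟩ := exists_abs_le_of_continuous hB 0 a
  intro x hx P hP
  have hdist : ∀ δ > 0, dist (ψ δ x) (φ₁ x) ≤ δ * exp (K * (x - 0)) := by
    intro δ hδ
    refine dist_le_of_trajectories_ODE_of_mem (v := fun t φ => z₁ + p t / z₁ * sin φ ^ 2)
      (s := fun _ => univ)
      (fun t ht => (lipschitzWith_add_mul_sin_sq (hK t (Ico_subset_Icc_self ht))).lipschitzOnWith)
      (fun t ht => (hψ' δ t ht).continuousAt.continuousWithinAt)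
      (fun t ht => (hψ' δ t (Ico_subset_Icc_self ht)).hasDerivWithinAt) (fun _ _ => mem_univ _)
      (fun t ht => (hφ₁ t ht).continuousAt.continuousWithinAt)
      (fun t ht => (hφ₁ t (Ico_subset_Icc_self ht)).hasDerivWithinAt) (fun _ _ => mem_univ _)
      ?_ x hx
    rw [hψ0, h₁, dist_zero_right, norm_eq_abs, abs_of_pos hδ]
  have hlim : Tendsto (fun δ => ψ δ x) (𝓝[>] 0) (𝓝 (φ₁ x)) := by
    rw [tendsto_iff_dist_tendsto_zero]
    have h0 : Tendsto (fun δ : ℝ => δ * exp (K * (x - 0))) (𝓝[>] 0) (𝓝 0) :=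
      (Continuous.tendsto' (by fun_prop) 0 0 (by simp)).mono_left nhdsWithin_le_nhds
    refine squeeze_zero' (Eventually.of_forall fun _ => dist_nonneg) ?_ h0
    filter_upwards [self_mem_nhdsWithin] with δ hδ using hdist δ hδ
  have hlim' := (hasDerivAt_tau_phase hz₁ hP.1 (φ₁ x)).continuousAt.tendsto.comp hlim
  refine ge_of_tendsto hlim' ?_
  filter_upwards [self_mem_nhdsWithin] with δ hδ
  exact (tau_lt_tau_of_pos hp ha hp_anti hp_nonneg hz₁ hz₁₂ (hψ' δ) hφ₂
    (by rw [hψ0]; exact hδ) h₂ x hx P hP).le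

theorem phase_div_le (hp : Continuous p) (ha : 0 ≤ a)
    (hp_anti : AntitoneOn p (Icc 0 a)) (hp_nonneg : ∀ x ∈ Icc 0 a, 0 ≤ p x) (hz₁ : 0 < z₁)
    (hz₁₂ : z₁ < z₂) (hφ₁ : IsPhase p a z₁ φ₁) (hφ₂ : IsPhase p a z₂ φ₂)
    (h₁ : φ₁ 0 = 0) (h₂ : φ₂ 0 = 0) : φ₂ a / z₂ ≤ φ₁ a / z₁ := by
  have := tau_le_tau hp ha hp_anti hp_nonneg hz₁ hz₁₂ hφ₁ hφ₂ h₁ h₂ a ⟨ha, le_rfl⟩ 0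
    ⟨le_rfl, hp_nonneg a ⟨ha, le_rfl⟩⟩
  rwa [tau_potential_zero hz₁, tau_potential_zero (hz₁.trans hz₁₂)] at this

theorem phase_div_lt (hp : Continuous p) (ha : 0 < a)
    (hp_anti : AntitoneOn p (Icc 0 a)) (hp_nonneg : ∀ x ∈ Icc 0 a, 0 ≤ p x) (hz₁ : 0 < z₁)
    (hz₁₂ : z₁ < z₂) (hφ₁ : IsPhase p a z₁ φ₁) (hφ₂ : IsPhase p a z₂ φ₂)
    (h₁ : φ₁ 0 = 0) (h₂ : φ₂ 0 = 0) (hp0 : 0 < p 0) : φ₂ a / z₂ < φ₁ a / z₁ := by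
  have hz₂ : 0 < z₂ := hz₁.trans hz₁₂
  have hle := tau_le_tau hp ha.le hp_anti hp_nonneg hz₁ hz₁₂ hφ₁ hφ₂ h₁ h₂
  have haI : a ∈ Icc 0 a := ⟨ha.le, le_rfl⟩
  have hφ₁_pos : ∀ x ∈ Ioc 0 a, 0 < φ₁ x := fun x hx => by
    simpa [h₁] using hφ₁.lt hz₁ hp_nonneg hx
  have hpa := hp_nonneg a haI
  rw [← tau_potential_zero hz₁, ← tau_potential_zero hz₂]
  rcases hpa.eq_or_lt with hpa0 | hpa_pos
  · obtain ⟨b, hbI, hpb⟩ : ∃ b ∈ Ioo 0 a, 0 < p b := by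
      have h := (hp.continuousAt.tendsto.eventually_const_lt hp0).filter_mono
        (nhdsWithin_le_nhds (s := Ioi 0))
      obtain ⟨b, hb, hb'⟩ := (h.and (Ioo_mem_nhdsGT ha)).exists
      exact ⟨b, hb', hb⟩
    have hsub : Icc b a ⊆ Icc 0 a := Icc_subset_Icc_left hbI.1.le
    have hrate : ∀ x ∈ Icc b a, tauRate z₂ (φ₂ x) (p x) < tauRate z₁ (φ₁ x) (p x) :=
      fun x hx => tauRate_lt hz₁ hz₁₂ (hp_nonneg x (hsub hx))
        (hφ₁_pos x ⟨hbI.1.trans_le hx.1, hx.2⟩)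
        (hle x (hsub hx) (p x) ⟨hp_nonneg x (hsub hx), le_rfl⟩)
    have hrate_cont : ∀ {z : ℝ} {φ : ℝ → ℝ}, 0 < z → IsPhase p a z φ →
        ContinuousOn (fun x => tauRate z (φ x) (p x)) (Icc b a) := fun hz hφ x hx =>
      (ContinuousAt.comp (f := fun x => (_, p x))
        (continuousAt_tauRate hz (hp_nonneg x (hsub hx)) _)
        ((hφ x (hsub hx)).continuousAt.prodMk hp.continuousAt)).continuousWithinAt
    obtain ⟨x₁, hx₁, hmin⟩ := isCompact_Icc.exists_isMinOn (nonempty_Icc.2 hbI.2.le)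
      ((hrate_cont hz₁ hφ₁).sub (hrate_cont hz₂ hφ₂))
    set η := (tauRate z₁ (φ₁ x₁) (p x₁) - tauRate z₂ (φ₂ x₁) (p x₁)) / 2 with hη
    have hη_pos : 0 < η := by have := hrate x₁ hx₁; rw [hη]; linarith
    have hmain := le_of_eventually_sub_mul_le one_pos
      (g := fun x => tau z₁ (φ₁ x) (p x) - tau z₂ (φ₂ x) (p x) + η * p x)
      ((((hφ₁.continuousOn_tau hz₁ hp hp_nonneg).sub
        (hφ₂.continuousOn_tau hz₂ hp hp_nonneg)).mono hsub).add (by fun_prop))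
      (fun y hy _ ε hε => by
        have hyI := Ico_subset_Icc_self hy
        have hsub' : Icc y a ⊆ Icc 0 a := (Icc_subset_Icc_left hy.1).trans hsub
        refine eventually_tau_sub_tau_le hz₁ hz₂ hy.2 hp (hp_anti.mono hsub')
          (fun w hw => hp_nonneg w (hsub' hw)) (hφ₁ y (hsub hyI)) (hφ₂ y (hsub hyI)) ?_ hε
        have := hmin hyI
        simp only [mem_ofPred_eq, Pi.sub_apply] at this
        linarith)
      a ⟨hbI.2.le, le_rfl⟩
    have hb := hle b (Ioo_subset_Icc_self hbI) (p b) ⟨hpb.le, le_rfl⟩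
    simp only [← hpa0, mul_zero, add_zero] at hmain
    have := mul_pos hη_pos hpb
    linarith
  · have hd : ∀ P ∈ Icc 0 (p a), HasDerivAt (fun P => tau z₁ (φ₁ a) P - tau z₂ (φ₂ a) P)
        (-tauRate z₁ (φ₁ a) P - -tauRate z₂ (φ₂ a) P) P := fun P hP =>
      (hasDerivAt_tau_potential hz₁ hP.1 _).sub (hasDerivAt_tau_potential hz₂ hP.1 _)
    have hanti : StrictAntiOn (fun P => tau z₁ (φ₁ a) P - tau z₂ (φ₂ a) P) (Icc 0 (p a)) :=
      strictAntiOn_of_hasDerivWithinAt_neg (convex_Icc _ _)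
        (fun P hP => (hd P hP).continuousAt.continuousWithinAt)
        (fun P hP => (hd P (interior_subset hP)).hasDerivWithinAt) (fun P hP => by
          have hP' := interior_subset hP
          have := tauRate_lt hz₁ hz₁₂ hP'.1 (hφ₁_pos a ⟨ha, le_rfl⟩) (hle a haI P hP')
          linarith)
    have := hanti ⟨le_rfl, hpa⟩ ⟨hpa, le_rfl⟩ hpa_pos
    have h := hle a haI (p a) ⟨hpa, le_rfl⟩
    simp only at this
    linarith

end Comparison

theorem exists_integrating_factor {k : ℝ → ℝ} {l : ℝ} (hl : 0 ≤ l)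
    (hk : ContinuousOn k (Icc 0 l)) :
    ∃ E : ℝ → ℝ, (∀ x, 0 < E x) ∧ ∀ x ∈ Icc 0 l, HasDerivAt E (-(k x * E x)) x := by
  have hc : Continuous (IccExtend hl ((Icc 0 l).domRestrict k)) :=
    hk.domRestrict.Icc_extend'
  refine ⟨fun x => exp (-∫ t in (0 : ℝ)..x, IccExtend hl ((Icc 0 l).domRestrict k) t),
    fun x => exp_pos _, fun x hx => ?_⟩
  have h := (hc.integral_hasStrictDerivAt 0 x).hasDerivAt
  refine h.neg.exp.congr_deriv ?_
  simp only [Pi.neg_apply]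
  rw [IccExtend_of_mem _ _ hx, domRestrict_apply]
  ring

theorem eq_zero_of_hasDerivAt_linear {f k : ℝ → ℝ} {l c : ℝ}
    (hk : ContinuousOn k (Icc 0 l)) (hf : ∀ x ∈ Icc 0 l, HasDerivAt f (k x * f x) x)
    (hc : c ∈ Icc 0 l) (hfc : f c = 0) : ∀ x ∈ Icc 0 l, f x = 0 := by
  obtain ⟨E, hE, hE'⟩ := exists_integrating_factor (hc.1.trans hc.2) hk
  have hd : ∀ x ∈ Icc 0 l, HasDerivAt (fun x => f x * E x) 0 x := fun x hx =>
    ((hf x hx).mul (hE' x hx)).congr_deriv (by ring)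
  have hconst := constant_of_has_deriv_right_zero
    (fun x hx => (hd x hx).continuousAt.continuousWithinAt)
    (fun x hx => (hd x (Ico_subset_Icc_self hx)).hasDerivWithinAt)
  have h0 := hconst c hc
  rw [hfc, zero_mul] at h0
  intro x hx
  have := hconst x hx
  rw [← h0] at this
  exact (mul_eq_zero.1 this).resolve_right (hE x).ne'

theorem nonneg_of_hasDerivAt_linear {f k g : ℝ → ℝ} {l : ℝ} (hl : 0 < l)
    (hk : ContinuousOn k (Icc 0 l)) (hf : ∀ x ∈ Icc 0 l, HasDerivAt f (k x * f x + g x) x)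
    (hf0 : f 0 = 0) (hg : ∀ x ∈ Icc 0 l, 0 ≤ g x) :
    0 ≤ f l ∧ (f l = 0 → ∀ x ∈ Icc 0 l, g x = 0) := by
  obtain ⟨E, hE, hE'⟩ := exists_integrating_factor hl.le hk
  have hd : ∀ x ∈ Icc 0 l, HasDerivAt (fun x => f x * E x) (g x * E x) x := fun x hx =>
    ((hf x hx).mul (hE' x hx)).congr_deriv (by ring)
  have hmono : MonotoneOn (fun x => f x * E x) (Icc 0 l) :=
    monotoneOn_of_hasDerivWithinAt_nonneg (convex_Icc _ _)
      (fun x hx => (hd x hx).continuousAt.continuousWithinAt)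
      (fun x hx => (hd x (interior_subset hx)).hasDerivWithinAt)
      (fun x hx => mul_nonneg (hg x (interior_subset hx)) (hE x).le)
  have h0 : (0 : ℝ) ∈ Icc 0 l := ⟨le_rfl, hl.le⟩
  have hlI : l ∈ Icc 0 l := ⟨hl.le, le_rfl⟩
  constructor
  · have := hmono h0 hlI hl.le
    simp only [hf0, zero_mul] at this
    exact nonneg_of_mul_nonneg_left this (hE l)
  · intro hfl x hx
    have hz : ∀ y ∈ Icc 0 l, f y * E y = 0 := fun y hy => by
      have h1 := hmono h0 hy hy.1
      have h2 := hmono hy hlI hy.2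
      simp only [hf0, hfl, zero_mul] at h1 h2
      exact le_antisymm h2 h1
    have h1 : HasDerivWithinAt (fun x => f x * E x) 0 (Icc 0 l) x :=
      (hasDerivWithinAt_const x (Icc 0 l) (0 : ℝ)).congr hz (hz x hx)
    have := (uniqueDiffOn_Icc hl x hx).eq_deriv _ (hd x hx).hasDerivWithinAt h1
    exact (mul_eq_zero.1 this).resolve_right (hE x).ne'

theorem mul_sinc (x : ℝ) : x * sinc x = sin x := by
  by_cases hx : x = 0
  · simp [hx]
  · rw [sinc_of_ne_zero hx, mul_div_cancel₀ _ hx]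

theorem sin_sq_sub_sin_sq (x y : ℝ) :
    sin x ^ 2 - sin y ^ 2 = sinc (x - y) * sin (x + y) * (x - y) := by
  rw [mul_right_comm, mul_comm (sinc _), mul_sinc, sin_sub, sin_add]
  have hx := sin_sq_add_cos_sq x
  have hy := sin_sq_add_cos_sq y
  linear_combination sin y ^ 2 * hx - sin x ^ 2 * hy

/-- `φ` is the Prüfer angle, with scale `z`, of the solution of `-y'' + Q y = lam y` on `[0, l]`
that vanishes at `0`: `y = r sin φ`, `y' = z r cos φ`. -/
structure IsPruferAngle (Q : ℝ → ℝ) (l z lam : ℝ) (φ : ℝ → ℝ) : Prop where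
  zero : φ 0 = 0
  hasDerivAt : ∀ x ∈ Icc 0 l, HasDerivAt φ (z + ((lam - Q x) / z - z) * sin (φ x) ^ 2) x

section Prufer

variable {Q : ℝ → ℝ} {l z lam lam' : ℝ} {φ φ' : ℝ → ℝ}

theorem exists_isPruferAngle (hQ : Continuous Q) (hl : 0 < l) (z lam : ℝ) :
    ∃ φ, IsPruferAngle Q l z lam φ := by
  obtain ⟨φ, h0, h⟩ := exists_hasDerivAt_add_mul_sin_sq z
    (B := fun x => (lam - Q x) / z - z) (by fun_prop) 0 (l + 1) (by positivity)
  exact ⟨φ, h0, fun x hx => h x ⟨by linarith [hx.1], by linarith [hx.2]⟩⟩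

theorem IsPruferAngle.continuousOn (h : IsPruferAngle Q l z lam φ) : ContinuousOn φ (Icc 0 l) :=
  fun x hx => (h.hasDerivAt x hx).continuousAt.continuousWithinAt

theorem IsPruferAngle.exists_sin_ne_zero (h : IsPruferAngle Q l z lam φ) (hl : 0 < l)
    (hz : 0 < z) : ∃ x ∈ Icc 0 l, sin (φ x) ≠ 0 := by
  by_contra! hcon
  have h0 : (0 : ℝ) ∈ Icc 0 l := ⟨le_rfl, hl.le⟩
  have h1 : HasDerivWithinAt (fun x => sin (φ x)) 0 (Icc 0 l) 0 :=
    (hasDerivWithinAt_const 0 (Icc 0 l) (0 : ℝ)).congr hcon (hcon 0 h0)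
  have := (uniqueDiffOn_Icc hl 0 h0).eq_deriv _ (h.hasDerivAt 0 h0).sin.hasDerivWithinAt h1
  simp [h.zero, hz.ne'] at this

theorem IsPruferAngle.pos (h : IsPruferAngle Q l z lam φ) (hQ : Continuous Q) (hl : 0 < l)
    (hz : 0 < z) : 0 < φ l := by
  have hφ := h.continuousOn
  have := nonneg_of_hasDerivAt_linear (f := φ) (g := fun _ => z) hl
    (k := fun x => ((lam - Q x) / z - z) * (sin (φ x) * sinc (φ x)))
    (((((continuous_const.sub hQ).div_const z).sub continuous_const).continuousOn).mul
      ((continuous_sin.comp_continuousOn hφ).mul (continuous_sinc.comp_continuousOn hφ)))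
    (fun x hx => (h.hasDerivAt x hx).congr_deriv (by
      linear_combination -((lam - Q x) / z - z) * sin (φ x) * mul_sinc (φ x)))
    h.zero (fun _ _ => hz.le)
  refine this.1.lt_of_ne fun h0 => hz.ne' (this.2 h0.symm 0 ⟨le_rfl, hl.le⟩)

theorem IsPruferAngle.lt_of_lt (h : IsPruferAngle Q l z lam φ) (h' : IsPruferAngle Q l z lam' φ')
    (hQ : Continuous Q) (hl : 0 < l) (hz : 0 < z) (hlam : lam < lam') : φ l < φ' l := by
  have hφ := h.continuousOn
  have hφ' := h'.continuousOn
  have := nonneg_of_hasDerivAt_linear (f := fun x => φ' x - φ x)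
    (g := fun x => (lam' - lam) / z * sin (φ x) ^ 2) hl
    (k := fun x => ((lam' - Q x) / z - z) * (sinc (φ' x - φ x) * sin (φ' x + φ x)))
    (((((continuous_const.sub hQ).div_const z).sub continuous_const).continuousOn).mul
      ((continuous_sinc.comp_continuousOn (hφ'.sub hφ)).mul
        (continuous_sin.comp_continuousOn (hφ'.add hφ))))
    (fun x hx => ((h'.hasDerivAt x hx).sub (h.hasDerivAt x hx)).congr_deriv (by
      linear_combination ((lam' - Q x) / z - z) * sin_sq_sub_sin_sq (φ' x) (φ x)))
    (by simp [h.zero, h'.zero])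
    (fun x _ => mul_nonneg (div_nonneg (sub_nonneg.2 hlam.le) hz.le) (sq_nonneg _))
  refine sub_pos.1 (this.1.lt_of_ne fun h0 => ?_)
  obtain ⟨x, hx, hsin⟩ := h.exists_sin_ne_zero hl hz
  have h1 := this.2 h0.symm x hx
  have h2 : 0 < (lam' - lam) / z := div_pos (sub_pos.2 hlam) hz
  have h3 : 0 < sin (φ x) ^ 2 := by positivity
  exact (mul_pos h2 h3).ne' h1

theorem IsPruferAngle.lt_pi (h : IsPruferAngle Q l z lam φ) (hl : 0 < l)
    (hz : 0 < z) (hlam : ∀ x ∈ Icc 0 l, lam ≤ Q x) : φ l < π := by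
  have hφ := h.continuousOn
  have hα : Continuous fun x => arctan (z * x) := continuous_arctan.comp (by fun_prop)
  have := nonneg_of_hasDerivAt_linear (f := fun x => arctan (z * x) - φ x)
    (g := fun x => (Q x - lam) / z * sin (φ x) ^ 2) hl
    (k := fun x => -z * (sinc (arctan (z * x) - φ x) * sin (arctan (z * x) + φ x)))
    (continuousOn_const.mul ((continuous_sinc.comp_continuousOn (hα.continuousOn.sub hφ)).mul
        (continuous_sin.comp_continuousOn (hα.continuousOn.add hφ))))
    (fun x hx => (((hasDerivAt_id x).const_mul z).arctan.sub (h.hasDerivAt x hx)).congr_deriv (by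
      have hc : 1 / (1 + (z * x) ^ 2) = 1 - sin (arctan (z * x)) ^ 2 := by
        rw [← cos_sq_arctan, cos_sq']
      simp only [id, mul_one]
      rw [hc]
      linear_combination -z * sin_sq_sub_sin_sq (arctan (z * x)) (φ x)))
    (by simp [h.zero])
    (fun x hx => mul_nonneg (div_nonneg (sub_nonneg.2 (hlam x hx)) hz.le) (sq_nonneg _))
  have h2 := arctan_lt_pi_div_two (z * l)
  linarith [this.1, pi_pos]

theorem continuous_pruferAngle {φ : ℝ → ℝ → ℝ} (h : ∀ lam, IsPruferAngle Q l z lam (φ lam))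
    (hQ : Continuous Q) (hl : 0 < l) (hz : 0 < z) : Continuous fun lam => φ lam l := by
  rw [continuous_iff_continuousAt]
  intro lam₀
  obtain ⟨K, hK⟩ := exists_abs_le_of_continuous
    (B := fun x => (lam₀ - Q x) / z - z) (by fun_prop) 0 l
  have hdist : ∀ lam, dist (φ lam l) (φ lam₀ l) ≤
      gronwallBound 0 K (|lam - lam₀| / z + 0) (l - 0) := fun lam => by
    refine dist_le_of_approx_trajectories_ODE_of_mem
      (v := fun t φ => z + ((lam₀ - Q t) / z - z) * sin φ ^ 2) (s := fun _ => univ)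
      (fun t ht => (lipschitzWith_add_mul_sin_sq (hK t (Ico_subset_Icc_self ht))).lipschitzOnWith)
      (h lam).continuousOn
      (fun t ht => ((h lam).hasDerivAt t (Ico_subset_Icc_self ht)).hasDerivWithinAt)
      (fun t _ => ?_) (fun _ _ => mem_univ _) (h lam₀).continuousOn
      (fun t ht => ((h lam₀).hasDerivAt t (Ico_subset_Icc_self ht)).hasDerivWithinAt)
      (fun t _ => (dist_self _).le) (fun _ _ => mem_univ _) (by simp [(h _).zero])
      l ⟨hl.le, le_rfl⟩
    have heq : z + ((lam - Q t) / z - z) * sin (φ lam t) ^ 2 -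
        (z + ((lam₀ - Q t) / z - z) * sin (φ lam t) ^ 2) =
        (lam - lam₀) / z * sin (φ lam t) ^ 2 := by ring
    rw [dist_eq, heq, abs_mul, abs_div, abs_of_pos hz, abs_of_nonneg (sq_nonneg (sin _))]
    exact mul_le_of_le_one_right (by positivity) (sin_sq_le_one _)
  rw [ContinuousAt, tendsto_iff_dist_tendsto_zero]
  refine squeeze_zero (fun _ => dist_nonneg) hdist ?_
  have hg := gronwallBound_continuous_ε 0 K (l - 0)
  refine Continuous.tendsto' (hg.comp (by fun_prop)) _ _ ?_
  simp [gronwallBound_ε0_δ0]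

theorem IsPruferAngle.isDirichletEigenvalue (h : IsPruferAngle Q l z lam φ) (hQ : Continuous Q)
    (hl : 0 < l) (hz : 0 < z) (hsin : sin (φ l) = 0) : IsDirichletEigenvalue Q 0 l lam := by
  have hφ := h.continuousOn
  obtain ⟨R, hR, hR'⟩ := exists_integrating_factor hl.le
    (k := fun x => -(sin (φ x) * cos (φ x) * (z - (lam - Q x) / z)))
    (((continuous_sin.comp_continuousOn hφ).mul (continuous_cos.comp_continuousOn hφ)).mul
      ((continuous_const.sub ((continuous_const.sub hQ).div_const z)).continuousOn)).neg
  refine ⟨fun x => R x * sin (φ x), fun x => z * (R x * cos (φ x)), fun x hx => ?_,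
    fun x hx => ?_, ?_, by simp [h.zero], by simp [hsin]⟩
  · refine ((hR' x hx).mul (h.hasDerivAt x hx).sin).congr_deriv ?_
    ring
  · refine (((hR' x hx).mul (h.hasDerivAt x hx).cos).const_mul z).congr_deriv ?_
    have hc := sin_sq_add_cos_sq (φ x)
    have hg : z * ((lam - Q x) / z) = lam - Q x := mul_div_cancel₀ _ hz.ne'
    generalize (lam - Q x) / z = g at hg ⊢
    linear_combination z * R x * sin (φ x) * (z - g) * hc - R x * sin (φ x) * hg
  · obtain ⟨x, hx, hs⟩ := h.exists_sin_ne_zero hl hz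
    exact ⟨x, hx, mul_ne_zero (hR x).ne' hs⟩

theorem IsPruferAngle.sin_eq_zero (h : IsPruferAngle Q l z lam φ) (hQ : Continuous Q)
    (hl : 0 < l) (hz : 0 < z) (heig : IsDirichletEigenvalue Q 0 l lam) : sin (φ l) = 0 := by
  obtain ⟨y, y', hy, hy', ⟨x₁, hx₁, hyx₁⟩, hy0, hyl⟩ := heig
  by_contra hsin
  have hφ := h.continuousOn
  have h0 : (0 : ℝ) ∈ Icc 0 l := ⟨le_rfl, hl.le⟩
  have hlI : l ∈ Icc 0 l := ⟨hl.le, le_rfl⟩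
  have hκ : ContinuousOn (fun x => sin (φ x) * cos (φ x) * (z - (lam - Q x) / z)) (Icc 0 l) :=
    ((continuous_sin.comp_continuousOn hφ).mul (continuous_cos.comp_continuousOn hφ)).mul
      ((continuous_const.sub ((continuous_const.sub hQ).div_const z)).continuousOn)
  have hA := eq_zero_of_hasDerivAt_linear
    (f := fun x => z * (y x * cos (φ x)) - y' x * sin (φ x)) hκ.neg
    (fun x hx => ((((hy x hx).mul (h.hasDerivAt x hx).cos).const_mul z).sub
      ((hy' x hx).mul (h.hasDerivAt x hx).sin)).congr_deriv (by
        have hc := sin_sq_add_cos_sq (φ x)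
        have hg : z * ((lam - Q x) / z) = lam - Q x := mul_div_cancel₀ _ hz.ne'
        simp only [Pi.neg_apply]
        generalize (lam - Q x) / z = g at hg ⊢
        linear_combination z * y x * sin (φ x) * (z - g) * hc - y x * sin (φ x) * hg))
    h0 (by simp [hy0, h.zero])
  have hsc := fun x => sin_sq_add_cos_sq (φ x)
  have hrad : ∀ x ∈ Icc 0 l,
      (y x * sin (φ x) + y' x / z * cos (φ x)) * sin (φ x) = y x ∧
      z * ((y x * sin (φ x) + y' x / z * cos (φ x)) * cos (φ x)) = y' x := fun x hx => by
    have h1 := hA x hx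
    constructor
    · have h2 : y' x * sin (φ x) = z * (y x * cos (φ x)) := by linarith
      have h3 : y' x / z * cos (φ x) * sin (φ x) = y x * cos (φ x) ^ 2 := by
        field_simp
        linear_combination cos (φ x) * h2
      linear_combination h3 + y x * hsc x
    · have h3 : z * (y' x / z) = y' x := by field_simp
      linear_combination cos (φ x) ^ 2 * h3 + sin (φ x) * h1 + y' x * hsc x
  have hB := eq_zero_of_hasDerivAt_linear
    (f := fun x => y x * sin (φ x) + y' x / z * cos (φ x)) hκ
    (fun x hx => (((hy x hx).mul (h.hasDerivAt x hx).sin).add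
      (((hy' x hx).div_const z).mul (h.hasDerivAt x hx).cos)).congr_deriv (by
        obtain ⟨h1, h2⟩ := hrad x hx
        have hw : z * (y' x / z) = y' x := mul_div_cancel₀ _ hz.ne'
        have hv : (Q x - lam) * y x / z = -((lam - Q x) / z) * y x := by ring
        rw [hv]
        generalize (lam - Q x) / z = g
        generalize y' x / z = w at h1 h2 hw ⊢
        have h3 : (y x * sin (φ x) + w * cos (φ x)) * cos (φ x) = w :=
          mul_left_cancel₀ hz.ne' (h2.trans hw.symm)
        linear_combination (z - g) * (sin (φ x) ^ 2 * (cos (φ x) * h1 - sin (φ x) * h3)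
          - cos (φ x) * h1) - sin (φ x) * hw)) hlI (by
      have h1 := hA l hlI
      have h2 : y' l = 0 := by simpa [hyl, hsin] using h1
      simp [hyl, h2])
  have := (hrad x₁ hx₁).1
  rw [hB x₁ hx₁, zero_mul] at this
  exact hyx₁ this.symm

end Prufer

section Enumeration

variable {Q : ℝ → ℝ} {l z : ℝ}

theorem exists_isPruferAngle_eq_mul_pi (hQ : Continuous Q) (hl : 0 < l) (hz : 0 < z)
    {μ : ℕ+ → ℝ} (hμ_mono : StrictMono μ)
    (hμ_eig : ∀ n, IsDirichletEigenvalue Q 0 l (μ n))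
    (hμ_all : ∀ lam, IsDirichletEigenvalue Q 0 l lam → ∃ n, μ n = lam) (n : ℕ+) :
    ∃ φ, IsPruferAngle Q l z (μ n) φ ∧ φ l = n * π := by
  choose φ hφ using fun lam => exists_isPruferAngle hQ hl z lam
  have hmono : StrictMono fun lam => φ lam l := fun a b hab =>
    (hφ a).lt_of_lt (hφ b) hQ hl hz hab
  have hk : ∀ n, ∃ k : ℕ+, φ (μ n) l = k * π := fun n => by
    obtain ⟨j, hj⟩ := sin_eq_zero_iff.1 ((hφ (μ n)).sin_eq_zero hQ hl hz (hμ_eig n))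
    have hpos := (hφ (μ n)).pos hQ hl hz
    rw [← hj] at hpos
    have hj0 : 0 < j := by exact_mod_cast pos_of_mul_pos_left hpos pi_pos.le
    lift j to ℕ using hj0.le
    exact ⟨⟨j, by exact_mod_cast hj0⟩, by rw [← hj]; simp⟩
  choose k hk using hk
  have hk_mono : StrictMono k := fun a b hab => by
    have h : φ (μ a) l < φ (μ b) l := hmono (hμ_mono hab)
    rw [hk, hk] at h
    exact_mod_cast lt_of_mul_lt_mul_right h pi_pos.le
  obtain ⟨M, hM⟩ := exists_abs_le_of_continuous hQ 0 l
  have hlow : φ (-M) l < π := (hφ (-M)).lt_pi hl hz fun x hx => (abs_le.1 (hM x hx)).1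
  have hk_surj : range k = range (id : ℕ+ → ℕ+) := by
    rw [range_id, eq_univ_iff_forall]
    intro m
    have hm : (1 : ℝ) ≤ m := by exact_mod_cast (one_le : 1 ≤ m)
    have hmk : (m : ℝ) ≤ k m := by exact_mod_cast hk_mono.le_apply
    obtain ⟨lam, hlam⟩ := mem_range_of_exists_le_of_exists_ge
      (c := m * π) (continuous_pruferAngle hφ hQ hl hz)
      ⟨-M, hlow.le.trans (le_mul_of_one_le_left pi_pos.le hm)⟩
      ⟨μ m, by rw [hk]; exact mul_le_mul_of_nonneg_right hmk pi_pos.le⟩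
    have hlam' : φ lam l = m * π := hlam
    obtain ⟨j, rfl⟩ := hμ_all lam ((hφ lam).isDirichletEigenvalue hQ hl hz
      (by rw [hlam']; exact sin_nat_mul_pi m))
    refine ⟨j, ?_⟩
    rw [hk] at hlam'
    exact_mod_cast mul_right_cancel₀ pi_ne_zero hlam'
  have hk_id : k = id := (hk_mono.range_inj strictMono_id).1 hk_surj
  exact ⟨φ (μ n), hφ _, by rw [hk, hk_id, id]⟩

theorem IsPruferAngle.isPhase {φ : ℝ → ℝ} (h : IsPruferAngle Q l z (z ^ 2) φ) (hz : 0 < z) :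
    IsPhase (fun x => -Q x) l z φ := fun x hx =>
  (h.hasDerivAt x hx).congr_deriv (by field_simp; ring)

end Enumeration

section Rigidity

variable {p : ℝ → ℝ} {c l z z₁ z₂ : ℝ} {φ φ₁ φ₂ : ℝ → ℝ}

theorem IsPhase.mono (h : IsPhase p l z φ) (hc : c ≤ l) : IsPhase p c z φ :=
  fun x hx => h x ⟨hx.1, hx.2.trans hc⟩

theorem IsPhase.reflect (h : IsPhase p l z φ) (hsin : sin (φ l) = 0) :
    IsPhase (fun s => p (l - s)) l z fun s => φ l - φ (l - s) := fun s hs => by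
  have h1 := h (l - s) ⟨by linarith [hs.2], by linarith [hs.1]⟩
  have h2 := (h1.comp s ((hasDerivAt_id s).const_sub l)).const_sub (φ l)
  refine h2.congr_deriv ?_
  have hc : cos (φ l) ^ 2 = 1 := by rw [cos_sq', hsin]; ring
  rw [sin_sub, hsin]
  linear_combination -(p (l - s) / z * sin (φ (l - s)) ^ 2) * hc

theorem eq_zero_of_phase_div_le (hp : Continuous p) (hl : 0 < l) (hc : c ∈ Icc 0 l)
    (hp_anti : AntitoneOn p (Icc 0 c)) (hp_mono : MonotoneOn p (Icc c l))
    (hp_nonneg : ∀ x ∈ Icc 0 l, 0 ≤ p x) (hz₁ : 0 < z₁) (hz₁₂ : z₁ < z₂)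
    (hφ₁ : IsPhase p l z₁ φ₁) (hφ₂ : IsPhase p l z₂ φ₂) (h₁ : φ₁ 0 = 0) (h₂ : φ₂ 0 = 0)
    (hs₁ : sin (φ₁ l) = 0) (hs₂ : sin (φ₂ l) = 0) (hle : φ₁ l / z₁ ≤ φ₂ l / z₂) :
    ∀ x ∈ Icc 0 l, p x = 0 := by
  have hlc : l - c ≤ l := sub_le_self _ hc.1
  have hr : Continuous fun s => p (l - s) := by fun_prop
  have hr_anti : AntitoneOn (fun s => p (l - s)) (Icc 0 (l - c)) := fun s hs t ht hst =>
    hp_mono ⟨by linarith [ht.2], by linarith [ht.1]⟩ ⟨by linarith [hs.2], by linarith [hs.1]⟩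
      (by linarith)
  have hp_left : ∀ x ∈ Icc 0 c, 0 ≤ p x := fun x hx => hp_nonneg x ⟨hx.1, hx.2.trans hc.2⟩
  have hp_right : ∀ s ∈ Icc 0 (l - c), 0 ≤ p (l - s) := fun s hs =>
    hp_nonneg _ ⟨by linarith [hs.2, hc.1], by linarith [hs.1]⟩
  have hleft := phase_div_le hp hc.1 hp_anti hp_left hz₁ hz₁₂ (hφ₁.mono hc.2) (hφ₂.mono hc.2) h₁ h₂
  have hright := phase_div_le hr (sub_nonneg.2 hc.2) hr_anti hp_right hz₁ hz₁₂
    ((hφ₁.reflect hs₁).mono hlc) ((hφ₂.reflect hs₂).mono hlc) (by simp) (by simp)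
  simp only [sub_sub_cancel, sub_div] at hright
  have hzero_left : 0 < c → p 0 = 0 := fun hc0 => by
    by_contra hp0
    have := phase_div_lt hp hc0 hp_anti hp_left hz₁ hz₁₂ (hφ₁.mono hc.2) (hφ₂.mono hc.2) h₁ h₂
      ((hp_nonneg 0 ⟨le_rfl, hl.le⟩).lt_of_ne' hp0)
    linarith
  have hzero_right : c < l → p l = 0 := fun hcl => by
    by_contra hpl
    have := phase_div_lt hr (sub_pos.2 hcl) hr_anti hp_right hz₁ hz₁₂
      ((hφ₁.reflect hs₁).mono hlc) ((hφ₂.reflect hs₂).mono hlc) (by simp) (by simp)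
      (by simpa using (hp_nonneg l ⟨hl.le, le_rfl⟩).lt_of_ne' hpl)
    simp only [sub_sub_cancel, sub_div] at this
    linarith
  intro x hx
  refine le_antisymm ?_ (hp_nonneg x hx)
  rcases lt_or_ge x c with hxc | hxc
  · have hc0 : 0 < c := hx.1.trans_lt hxc
    exact (hp_anti ⟨le_rfl, hc0.le⟩ ⟨hx.1, hxc.le⟩ hx.1).trans (hzero_left hc0).le
  · rcases hc.2.lt_or_eq with hcl | rfl
    · exact (hp_mono ⟨hxc, hx.2⟩ ⟨hcl.le, le_rfl⟩ hx.2).trans (hzero_right hcl).le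
    · exact (hp_anti ⟨le_rfl, hl.le⟩ hx hx.1).trans (hzero_left hl).le

end Rigidity

theorem isDirichletEigenvalue_congr {q r : ℝ → ℝ} {a b lam : ℝ} (h : EqOn q r (Icc a b)) :
    IsDirichletEigenvalue q a b lam ↔ IsDirichletEigenvalue r a b lam := by
  unfold IsDirichletEigenvalue
  refine exists_congr fun y => exists_congr fun y' => and_congr Iff.rfl (and_congr ?_ Iff.rfl)
  refine forall₂_congr fun x hx => ?_
  rw [h hx]

/-!
**Statement 5.**  Let `q : [0,1] → ℝ` be continuous, nonpositive and single-barrier,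
and let `ℓ₀ ∈ (0,1]` be such that the eigenvalues `λ₁(ℓ₀) < λ₂(ℓ₀) < ⋯` of the
Dirichlet problem `−y'' + q y = λ y` on `[0,ℓ₀]`, `y 0 = y ℓ₀ = 0`, satisfy
`λ₁(ℓ₀) > 0` and `λ_n(ℓ₀)/λ_m(ℓ₀) ≥ n²/m²` for all `n > m ≥ 1`.  If for two
different indices `n ≠ m` the equality `λ_n(ℓ₀) / λ_m(ℓ₀) = n² / m²` holds, then
`q ≡ 0` on `[0,ℓ₀]`; conversely, if `q ≡ 0` on `[0,ℓ₀]` then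
`λ_n(ℓ₀) / λ_m(ℓ₀) = n² / m²` for all `n, m`.
-/
theorem truncated_eigenvalue_ratio_equality_iff_q_zero
    (q : ℝ → ℝ) (x₀ : ℝ) (hx₀ : x₀ ∈ Set.Icc (0 : ℝ) 1)
    (hq_cont : ContinuousOn q (Set.Icc 0 1))
    (hq_nonpos : ∀ x ∈ Set.Icc (0 : ℝ) 1, q x ≤ 0)
    (hq_inc : MonotoneOn q (Set.Icc 0 x₀))
    (hq_dec : AntitoneOn q (Set.Icc x₀ 1))
    (l₀ : ℝ) (hl₀ : l₀ ∈ Set.Ioc (0 : ℝ) 1)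
    -- `μ n` is the `n`-th Dirichlet eigenvalue on `[0, l₀]`: `μ` is the strictly
    -- increasing enumeration of the whole spectrum
    (μ : ℕ+ → ℝ) (hμ_mono : StrictMono μ)
    (hμ_eig : ∀ n : ℕ+, IsDirichletEigenvalue q 0 l₀ (μ n))
    (hμ_all : ∀ lam : ℝ, IsDirichletEigenvalue q 0 l₀ lam → ∃ n : ℕ+, μ n = lam)
    (hμ_pos : 0 < μ 1)
    (hμ_ratio : ∀ n m : ℕ+, m < n → (n : ℝ) ^ 2 / (m : ℝ) ^ 2 ≤ μ n / μ m) :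
    ((∃ n m : ℕ+, n ≠ m ∧ μ n / μ m = (n : ℝ) ^ 2 / (m : ℝ) ^ 2) →
      ∀ x ∈ Set.Icc (0 : ℝ) l₀, q x = 0) ∧
    ((∀ x ∈ Set.Icc (0 : ℝ) l₀, q x = 0) →
      ∀ n m : ℕ+, μ n / μ m = (n : ℝ) ^ 2 / (m : ℝ) ^ 2) := by
  obtain ⟨hl, hl1⟩ := hl₀
  have hsub : Icc 0 l₀ ⊆ Icc (0 : ℝ) 1 := Icc_subset_Icc_right hl1
  obtain ⟨Q, hQ, hQq⟩ : ∃ Q : ℝ → ℝ, Continuous Q ∧ EqOn q Q (Icc 0 l₀) :=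
    ⟨IccExtend zero_le_one ((Icc 0 1).domRestrict q), hq_cont.domRestrict.Icc_extend',
      fun x hx => (IccExtend_of_mem zero_le_one ((Icc 0 1).domRestrict q) (hsub hx)).symm⟩
  have hpos : ∀ n, 0 < μ n := fun n => hμ_pos.trans_le (hμ_mono.monotone one_le)
  have hangle : ∀ n, ∃ φ, IsPruferAngle Q l₀ (√(μ n)) (√(μ n) ^ 2) φ ∧ φ l₀ = n * π := fun n => by
    rw [sq_sqrt (hpos n).le]
    exact exists_isPruferAngle_eq_mul_pi hQ hl (sqrt_pos.2 (hpos n)) hμ_mono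
      (fun k => (isDirichletEigenvalue_congr hQq).1 (hμ_eig k))
      (fun lam hlam => hμ_all lam ((isDirichletEigenvalue_congr hQq).2 hlam)) n
  choose φ hφ hφl using hangle
  have hphase := fun n => (hφ n).isPhase (sqrt_pos.2 (hpos n))
  have hsqrt : ∀ n, √(μ n) ≠ 0 := fun n => (sqrt_pos.2 (hpos n)).ne'
  have hcast : ∀ n : ℕ+, (n : ℝ) ≠ 0 := fun n => by exact_mod_cast n.ne_zero
  constructor
  · rintro ⟨n, m, hnm, heq⟩
    have hratio : (m : ℝ) / √(μ m) = n / √(μ n) := by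
      rw [← abs_of_pos (a := (m : ℝ) / √(μ m)) (by have := hpos m; positivity),
        ← abs_of_pos (a := (n : ℝ) / √(μ n)) (by have := hpos n; positivity),
        ← sq_eq_sq_iff_abs_eq_abs, div_pow, div_pow, sq_sqrt (hpos m).le, sq_sqrt (hpos n).le]
      have h1 := (hpos n).ne'
      have h2 := (hpos m).ne'
      have h3 := hcast n
      have h4 := hcast m
      field_simp at heq ⊢
      linarith
    have hsame : φ m l₀ / √(μ m) = φ n l₀ / √(μ n) := by
      rw [hφl, hφl, mul_div_right_comm, mul_div_right_comm, hratio]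
    have hsin : ∀ k, sin (φ k l₀) = 0 := fun k => by rw [hφl]; exact sin_nat_mul_pi k
    have key : ∀ i j, i < j → φ i l₀ / √(μ i) = φ j l₀ / √(μ j) →
        ∀ x ∈ Icc 0 l₀, -Q x = 0 := fun i j hij h =>
      eq_zero_of_phase_div_le (c := min x₀ l₀) hQ.neg hl ⟨le_min hx₀.1 hl.le, min_le_right _ _⟩
        (fun x hx y hy hxy => by
          rw [← hQq ⟨hx.1, hx.2.trans (min_le_right _ _)⟩,
            ← hQq ⟨hy.1, hy.2.trans (min_le_right _ _)⟩]
          exact neg_le_neg (hq_inc ⟨hx.1, hx.2.trans (min_le_left _ _)⟩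
            ⟨hy.1, hy.2.trans (min_le_left _ _)⟩ hxy))
        (fun x hx y hy hxy => by
          rcases le_total x₀ l₀ with hxl | hxl
          · rw [min_eq_left hxl] at hx hy
            rw [← hQq ⟨hx₀.1.trans hx.1, hx.2⟩, ← hQq ⟨hx₀.1.trans hy.1, hy.2⟩]
            exact neg_le_neg (hq_dec ⟨hx.1, hx.2.trans hl1⟩ ⟨hy.1, hy.2.trans hl1⟩ hxy)
          · rw [min_eq_right hxl, Icc_self, mem_singleton_iff] at hx hy
            rw [hx, hy])
        (fun x hx => by
          rw [← hQq hx]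
          exact neg_nonneg.2 (hq_nonpos x (hsub hx)))
        (sqrt_pos.2 (hpos i)) (sqrt_lt_sqrt (hpos i).le (hμ_mono hij)) (hphase i) (hphase j)
        (hφ i).zero (hφ j).zero (hsin i) (hsin j) h.le
    intro x hx
    rw [hQq hx]
    rcases hnm.lt_or_gt with h | h
    · exact neg_eq_zero.1 (key n m h hsame.symm x hx)
    · exact neg_eq_zero.1 (key m n h hsame x hx)
  · intro hq0
    have hlin : ∀ n, n * π = √(μ n) * l₀ := fun n => by
      have h := constant_of_has_deriv_right_zero (f := fun x => φ n x - √(μ n) * x)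
        (a := 0) (b := l₀)
        ((hφ n).continuousOn.sub (by fun_prop))
        (fun x hx => (((hphase n x (Ico_subset_Icc_self hx)).sub
          ((hasDerivAt_id x).const_mul (√(μ n)))).congr_deriv (by
            simp [← hQq (Ico_subset_Icc_self hx), hq0 x (Ico_subset_Icc_self hx)])).hasDerivWithinAt)
        l₀ ⟨hl.le, le_rfl⟩
      simp only [(hφ n).zero, hφl, mul_zero, sub_zero] at h
      linarith
    have hμ : ∀ n, μ n = (n * π / l₀) ^ 2 := fun n => by
      rw [hlin, mul_div_cancel_right₀ _ hl.ne', sq_sqrt (hpos n).le]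
    intro n m
    have h1 := pi_ne_zero
    have h2 := hl.ne'
    have h3 := hcast m
    rw [hμ, hμ]
    field_simp
end

section
/- Let q : [0,1] → ℝ be continuous, nonpositive (q(x) ≤ 0 on [0,1]) and increasing on [0,1], and set q₋ = min{q(x) : x ∈ [0,1]}. Let λ₁ < λ₂ < ⋯ denote the eigenvalues of the Dirichlet–Neumann problem −y'' + q(x) y = λ y on [0,1] with y(0) = y'(1) = 0. Then for any indices n, m with λ_n > λ_m ≥ −2q₋, one has λ_n / λ_m ≥ (2n−1)² / (2m−1)². -/
/-- `lam` is an eigenvalue of the Dirichlet–Neumann problem `−y'' + q y = λ y` on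
`[0,1]`, `y 0 = 0`, `y' 1 = 0`: there is a nontrivial solution (with derivative `y'`
and `y'' = (q − λ) y` on `[0,1]`) satisfying the boundary conditions. -/
def IsDirichletNeumannEigenvalue (q : ℝ → ℝ) (lam : ℝ) : Prop :=
  ∃ y y' : ℝ → ℝ,
    (∀ x ∈ Set.Icc (0 : ℝ) 1, HasDerivAt y (y' x) x) ∧
    (∀ x ∈ Set.Icc (0 : ℝ) 1, HasDerivAt y' ((q x - lam) * y x) x) ∧
    (∃ x ∈ Set.Icc (0 : ℝ) 1, y x ≠ 0) ∧
    y 0 = 0 ∧ y' 1 = 0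

section Pruefer

open Real Set Filter Topology

/-! ### Trigonometric inequalities -/

/-- A form of the Cusa–Huygens inequality. -/
lemma three_mul_sin_le {t : ℝ} (ht : 0 ≤ t) : 3 * sin t ≤ t * (2 + cos t) := by
  rcases le_total π t with h | h
  · have h1 := sin_le_one t
    have h2 := neg_one_le_cos t
    have h3 := pi_gt_three
    nlinarith
  have h1 : ∀ x ∈ Icc 0 π, 0 ≤ sin x - x * cos x := by
    have hm : MonotoneOn (fun x : ℝ => sin x - x * cos x) (Icc 0 π) := by
      refine monotoneOn_of_hasDerivWithinAt_nonneg (f' := fun x => x * sin x)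
        (convex_Icc 0 π) (by fun_prop) (fun x _ => ?_) (fun x hx => ?_)
      · have := (hasDerivAt_sin x).fun_sub ((hasDerivAt_id' x).fun_mul (hasDerivAt_cos x))
        exact (this.congr_deriv (by ring)).hasDerivWithinAt
      · rw [interior_Icc] at hx
        exact mul_nonneg hx.1.le (sin_pos_of_mem_Ioo hx).le
    intro x hx
    simpa using hm ⟨le_rfl, pi_pos.le⟩ hx hx.1
  have h2 : ∀ x ∈ Icc 0 π, 0 ≤ 2 - 2 * cos x - x * sin x := by
    have hm : MonotoneOn (fun x : ℝ => 2 - 2 * cos x - x * sin x) (Icc 0 π) := by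
      refine monotoneOn_of_hasDerivWithinAt_nonneg (f' := fun x => sin x - x * cos x)
        (convex_Icc 0 π) (by fun_prop) (fun x _ => ?_) (fun x hx => ?_)
      · have := (((hasDerivAt_cos x).const_mul 2).const_sub 2).fun_sub
          ((hasDerivAt_id' x).fun_mul (hasDerivAt_sin x))
        exact (this.congr_deriv (by ring)).hasDerivWithinAt
      · rw [interior_Icc] at hx
        exact h1 x ⟨hx.1.le, hx.2.le⟩
    intro x hx
    simpa using hm ⟨le_rfl, pi_pos.le⟩ hx hx.1
  have hm : MonotoneOn (fun x : ℝ => x * (2 + cos x) - 3 * sin x) (Icc 0 π) := by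
    refine monotoneOn_of_hasDerivWithinAt_nonneg (f' := fun x => 2 - 2 * cos x - x * sin x)
      (convex_Icc 0 π) (by fun_prop) (fun x _ => ?_) (fun x hx => ?_)
    · have := ((hasDerivAt_id' x).fun_mul ((hasDerivAt_cos x).const_add 2)).fun_sub
        ((hasDerivAt_sin x).const_mul 3)
      exact (this.congr_deriv (by ring)).hasDerivWithinAt
    · rw [interior_Icc] at hx
      exact h2 x ⟨hx.1.le, hx.2.le⟩
  have := hm ⟨le_rfl, pi_pos.le⟩ ⟨ht, h⟩ ht
  simp at this
  linarith

lemma antitoneOn_div_sq_sub_sin {p : ℝ} (hp : 0 ≤ p) :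
    AntitoneOn (fun w : ℝ => p / w ^ 2 - sin (2 * (w * p)) / (2 * w ^ 3)) (Ioi 0) := by
  refine antitoneOn_of_hasDerivWithinAt_nonpos
    (f' := fun w => (3 * sin (2 * (w * p)) - 2 * (w * p) * (2 + cos (2 * (w * p)))) / (2 * w ^ 4))
    (convex_Ioi 0) ?_ (fun w hw => ?_) (fun w hw => ?_)
  · intro w hw
    have hw' : w ≠ 0 := (mem_Ioi.1 hw).ne'
    refine ContinuousAt.continuousWithinAt ?_
    fun_prop (disch := simp [hw'])
  · rw [interior_Ioi] at hw
    have hw' : w ≠ 0 := (mem_Ioi.1 hw).ne'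
    have h1 := ((hasDerivAt_pow 2 w).fun_inv (pow_ne_zero 2 hw')).const_mul p
    have h2 : HasDerivAt (fun w : ℝ => sin (2 * (w * p))) (cos (2 * (w * p)) * (2 * (1 * p))) w :=
      (((hasDerivAt_id w).mul_const p).const_mul 2).sin
    have h3 := h2.fun_div ((hasDerivAt_pow 3 w).const_mul 2)
      (mul_ne_zero two_ne_zero (pow_ne_zero 3 hw'))
    simp only [div_eq_mul_inv p]
    refine ((h1.fun_sub h3).congr_deriv ?_).hasDerivWithinAt
    push_cast
    field_simp
    ring
  · rw [interior_Ioi] at hw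
    have hw' : 0 < w := hw
    have := three_mul_sin_le (t := 2 * (w * p)) (by positivity)
    exact div_nonpos_of_nonpos_of_nonneg (by linarith) (by positivity)

/-! ### Rescaling of angles -/

/-- The lift to `ℝ` of the map `tan θ ↦ s * tan θ`. -/
noncomputable def scaleAngle (s θ : ℝ) : ℝ :=
  θ + arctan ((s - 1) * (sin θ * cos θ) / (cos θ ^ 2 + s * sin θ ^ 2))

lemma cos_sq_add_mul_sin_sq_pos {s : ℝ} (hs : 0 < s) (θ : ℝ) : 0 < cos θ ^ 2 + s * sin θ ^ 2 := by
  have := sin_sq_add_cos_sq θ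
  rcases eq_or_ne (cos θ) 0 with h | h
  · rw [h] at this ⊢
    have : sin θ ^ 2 = 1 := by linarith
    rw [this]; linarith
  · positivity

lemma scaleAngle_of_cos_eq_zero {θ : ℝ} (h : cos θ = 0) (s : ℝ) : scaleAngle s θ = θ := by
  simp [scaleAngle, h]

@[simp] lemma scaleAngle_zero (s : ℝ) : scaleAngle s 0 = 0 := by
  simp [scaleAngle]

lemma scaleAngle_le (s θ : ℝ) : scaleAngle s θ ≤ θ + π / 2 := by
  unfold scaleAngle
  linarith [(arctan_lt_pi_div_two ((s - 1) * (sin θ * cos θ) / (cos θ ^ 2 + s * sin θ ^ 2))).le]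

lemma scaleAngle_denom_identity (s θ : ℝ) :
    (cos θ ^ 2 + s * sin θ ^ 2) ^ 2 + ((s - 1) * (sin θ * cos θ)) ^ 2 =
      cos θ ^ 2 + s ^ 2 * sin θ ^ 2 := by
  have := sin_sq_add_cos_sq θ
  linear_combination (cos θ ^ 2 + s ^ 2 * sin θ ^ 2) * this

lemma hasDerivAt_scaleAngle_right {s : ℝ} (hs : 0 < s) (θ : ℝ) :
    HasDerivAt (scaleAngle s) (s / (cos θ ^ 2 + s ^ 2 * sin θ ^ 2)) θ := by
  have hA := cos_sq_add_mul_sin_sq_pos hs θ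
  have hC := cos_sq_add_mul_sin_sq_pos (pow_pos hs 2) θ
  have hid := scaleAngle_denom_identity s θ
  have h1 := sin_sq_add_cos_sq θ
  have hB' := (((hasDerivAt_sin θ).fun_mul (hasDerivAt_cos θ)).const_mul (s - 1)).fun_div
    (((hasDerivAt_cos θ).fun_pow 2).fun_add (((hasDerivAt_sin θ).fun_pow 2).const_mul s)) hA.ne'
  have h := (hasDerivAt_id' θ).fun_add hB'.arctan
  refine h.congr_deriv ?_
  have e : 1 + ((s - 1) * (sin θ * cos θ) / (cos θ ^ 2 + s * sin θ ^ 2)) ^ 2 =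
      (cos θ ^ 2 + s ^ 2 * sin θ ^ 2) / (cos θ ^ 2 + s * sin θ ^ 2) ^ 2 := by
    rw [← hid]; field_simp
  rw [e]
  field_simp
  push_cast
  linear_combination (s + (s - 1) * (cos θ ^ 2 - s * sin θ ^ 2)) * h1

lemma hasDerivAt_scaleAngle_left {s : ℝ} (hs : 0 < s) (θ : ℝ) :
    HasDerivAt (fun s => scaleAngle s θ) (sin θ * cos θ / (cos θ ^ 2 + s ^ 2 * sin θ ^ 2)) s := by
  have hA := cos_sq_add_mul_sin_sq_pos hs θ
  have hC := cos_sq_add_mul_sin_sq_pos (pow_pos hs 2) θ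
  have hid := scaleAngle_denom_identity s θ
  have h1 := sin_sq_add_cos_sq θ
  have hB' := (((hasDerivAt_id' s).sub_const 1).mul_const (sin θ * cos θ)).fun_div
    (((hasDerivAt_id' s).mul_const (sin θ ^ 2)).const_add (cos θ ^ 2)) hA.ne'
  have h := hB'.arctan.const_add θ
  refine h.congr_deriv ?_
  have e : 1 + ((s - 1) * (sin θ * cos θ) / (cos θ ^ 2 + s * sin θ ^ 2)) ^ 2 =
      (cos θ ^ 2 + s ^ 2 * sin θ ^ 2) / (cos θ ^ 2 + s * sin θ ^ 2) ^ 2 := by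
    rw [← hid]; field_simp
  rw [e]
  field_simp
  linear_combination (sin θ * cos θ) * h1

lemma sin_two_mul_scaleAngle {s : ℝ} (hs : 0 < s) (θ : ℝ) :
    sin (2 * scaleAngle s θ) = 2 * s * (sin θ * cos θ) / (cos θ ^ 2 + s ^ 2 * sin θ ^ 2) := by
  have hA := cos_sq_add_mul_sin_sq_pos hs θ
  have hC := cos_sq_add_mul_sin_sq_pos (pow_pos hs 2) θ
  have hid := scaleAngle_denom_identity s θ
  have h1 := sin_sq_add_cos_sq θ
  set x := (s - 1) * (sin θ * cos θ) / (cos θ ^ 2 + s * sin θ ^ 2) with hx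
  have e : 1 + x ^ 2 =
      (cos θ ^ 2 + s ^ 2 * sin θ ^ 2) / (cos θ ^ 2 + s * sin θ ^ 2) ^ 2 := by
    rw [← hid, hx]; field_simp
  have hc : cos (arctan x) ^ 2 = 1 / (1 + x ^ 2) := cos_sq_arctan x
  have hs' : sin (arctan x) = x * cos (arctan x) := by
    rw [sin_arctan, cos_arctan]; ring
  have hu : scaleAngle s θ = θ + arctan x := rfl
  have hsin : sin (2 * scaleAngle s θ) =
      2 * (sin θ + cos θ * x) * (cos θ - sin θ * x) * cos (arctan x) ^ 2 := by
    rw [sin_two_mul, hu, sin_add, cos_add, hs']; ring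
  rw [hsin, hc, e]
  have hxA : x * (cos θ ^ 2 + s * sin θ ^ 2) = (s - 1) * (sin θ * cos θ) :=
    div_mul_cancel₀ _ hA.ne'
  have f1 : (sin θ + cos θ * x) * (cos θ ^ 2 + s * sin θ ^ 2) = s * sin θ := by
    linear_combination (s * sin θ) * h1 + cos θ * hxA
  have f2 : (cos θ - sin θ * x) * (cos θ ^ 2 + s * sin θ ^ 2) = cos θ := by
    linear_combination cos θ * h1 - sin θ * hxA
  rw [one_div_div, mul_div_assoc', div_left_inj' hC.ne']
  linear_combination 2 * (cos θ - sin θ * x) * (cos θ ^ 2 + s * sin θ ^ 2) * f1 +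
    2 * s * sin θ * f2

lemma monotone_scaleAngle {s : ℝ} (hs : 0 < s) : Monotone (scaleAngle s) :=
  monotone_of_hasDerivAt_nonneg (hasDerivAt_scaleAngle_right hs)
    fun θ => (div_pos hs (cos_sq_add_mul_sin_sq_pos (pow_pos hs 2) θ)).le

lemma scaleAngle_nonneg {s θ : ℝ} (hs : 0 < s) (hθ : 0 ≤ θ) : 0 ≤ scaleAngle s θ := by
  simpa using monotone_scaleAngle hs hθ

/-! ### The time a frozen potential needs to produce a given angle -/

/-- If `q` is the constant `c`, the Prüfer angle of `-y'' + q y = lam y`, `y 0 = 0`, reaches the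
value `θ` at the time `frozenTime lam θ c`. -/
noncomputable def frozenTime (lam θ c : ℝ) : ℝ :=
  scaleAngle (√(lam - c)) θ / √(lam - c)

lemma frozenTime_nonneg {lam θ c : ℝ} (hc : c < lam) (hθ : 0 ≤ θ) : 0 ≤ frozenTime lam θ c :=
  div_nonneg (scaleAngle_nonneg (sqrt_pos.2 (sub_pos.2 hc)) hθ) (sqrt_nonneg _)

lemma hasDerivAt_frozenTime {lam c : ℝ} (θ : ℝ) (hc : c < lam) :
    HasDerivAt (frozenTime lam θ) ((frozenTime lam θ c / √(lam - c) ^ 2 -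
      sin (2 * (√(lam - c) * frozenTime lam θ c)) / (2 * √(lam - c) ^ 3)) / 2) c := by
  have hs : 0 < √(lam - c) := sqrt_pos.2 (sub_pos.2 hc)
  have hsc : √(lam - c) * frozenTime lam θ c = scaleAngle (√(lam - c)) θ :=
    mul_div_cancel₀ _ hs.ne'
  have hC := cos_sq_add_mul_sin_sq_pos (pow_pos hs 2) θ
  have h1 := ((hasDerivAt_id' c).const_sub lam).sqrt (sub_pos.2 hc).ne'
  have h2 := (HasDerivAt.comp c (hasDerivAt_scaleAngle_left hs θ) h1).fun_div h1 hs.ne'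
  refine h2.congr_deriv ?_
  rw [hsc, sin_two_mul_scaleAngle hs, frozenTime]
  simp only [Function.comp]
  field_simp
  ring

lemma hasDerivAt_frozenTime_comp {lam c x : ℝ} {θ : ℝ → ℝ} (hc : c < lam)
    (hθ : HasDerivAt θ (cos (θ x) ^ 2 + (lam - c) * sin (θ x) ^ 2) x) :
    HasDerivAt (fun t => frozenTime lam (θ t) c) 1 x := by
  have hs : 0 < √(lam - c) := sqrt_pos.2 (sub_pos.2 hc)
  have hC := cos_sq_add_mul_sin_sq_pos (pow_pos hs 2) (θ x)
  refine ((HasDerivAt.comp x (hasDerivAt_scaleAngle_right hs (θ x)) hθ).div_const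
    (√(lam - c))).congr_deriv ?_
  rw [sq_sqrt (sub_pos.2 hc).le] at hC ⊢
  field_simp

lemma continuousAt_frozenTime {lam : ℝ} {p : ℝ × ℝ} (hp : p.2 < lam) :
    ContinuousAt (fun p : ℝ × ℝ => frozenTime lam p.1 p.2) p := by
  have hs : 0 < √(lam - p.2) := sqrt_pos.2 (sub_pos.2 hp)
  have hA := cos_sq_add_mul_sin_sq_pos hs p.1
  unfold frozenTime scaleAngle
  fun_prop (disch := first | exact hs.ne' | exact hA.ne')

/-- With the angles fixed, a weighted difference of frozen times is increasing in the frozen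
value of the potential as long as it is nonpositive. -/
lemma exists_hasDerivAt_weighted_frozenTime_sub {lam lam' a b c M : ℝ} (hc : c < lam)
    (hlam : lam ≤ lam') (hb : 0 ≤ b) (hM : 1 / (lam - c) ≤ M)
    (hneg : exp (-M * c) * (frozenTime lam a c - frozenTime lam' b c) ≤ 0) :
    ∃ d, 0 ≤ d ∧ HasDerivAt
      (fun c => exp (-M * c) * (frozenTime lam a c - frozenTime lam' b c)) d c := by
  have hc' : c < lam' := hc.trans_le hlam
  have hs : 0 < √(lam - c) := sqrt_pos.2 (sub_pos.2 hc)
  have hsq : √(lam - c) ^ 2 = lam - c := sq_sqrt (sub_pos.2 hc).le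
  have hs' : √(lam - c) ≤ √(lam' - c) := sqrt_le_sqrt (by linarith)
  have hexp := ((hasDerivAt_id' c).const_mul (-M)).exp
  have h := hexp.fun_mul
    ((hasDerivAt_frozenTime a hc).fun_sub (hasDerivAt_frozenTime b hc'))
  refine ⟨_, ?_, h⟩
  have hD : frozenTime lam a c - frozenTime lam' b c ≤ 0 := by
    by_contra! hcon
    exact absurd hneg (not_le.2 (mul_pos (exp_pos _) hcon))
  have hp' : 0 ≤ frozenTime lam' b c := frozenTime_nonneg hc' hb
  have hanti := antitoneOn_div_sq_sub_sin hp' (mem_Ioi.2 hs) (mem_Ioi.2 (hs.trans_le hs')) hs'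
  simp only at hanti
  set p := frozenTime lam a c
  set p' := frozenTime lam' b c
  set s := √(lam - c)
  have hsin : |sin (2 * (s * p)) - sin (2 * (s * p'))| ≤ 2 * s * (p' - p) := by
    refine (abs_sin_sub_sin_le _ _).trans_eq ?_
    rw [abs_of_nonpos] <;> nlinarith
  have hlip : (p - p') / s ^ 2 * 2 ≤
      (p / s ^ 2 - sin (2 * (s * p)) / (2 * s ^ 3)) -
      (p' / s ^ 2 - sin (2 * (s * p')) / (2 * s ^ 3)) := by
    have h1 := (abs_le.1 hsin).2
    have h2 : (sin (2 * (s * p)) - sin (2 * (s * p'))) / (2 * s ^ 3) ≤ (p' - p) / s ^ 2 := by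
      rw [div_le_div_iff₀ (by positivity) (by positivity)]
      nlinarith [mul_le_mul_of_nonneg_right h1 (sq_nonneg s)]
    have e1 : (p' - p) / s ^ 2 = - ((p - p') / s ^ 2) := by ring
    have e2 : (p / s ^ 2 - sin (2 * (s * p)) / (2 * s ^ 3)) -
      (p' / s ^ 2 - sin (2 * (s * p')) / (2 * s ^ 3)) = (p - p') / s ^ 2 -
      (sin (2 * (s * p)) - sin (2 * (s * p'))) / (2 * s ^ 3) := by ring
    linarith
  have hMD : M * (p - p') ≤ (p - p') / s ^ 2 := by
    rw [div_eq_inv_mul, hsq, ← one_div]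
    exact mul_le_mul_of_nonpos_right hM hD
  have : 0 ≤ exp (-M * c) * (-(M * (p - p')) +
      ((p / s ^ 2 - sin (2 * (s * p)) / (2 * s ^ 3)) / 2 -
      (p' / √(lam' - c) ^ 2 - sin (2 * (√(lam' - c) * p')) / (2 * √(lam' - c) ^ 3)) / 2)) :=
    mul_nonneg (exp_pos _).le (by linarith)
  linarith

/-! ### One-sided comparison -/

/-- A continuous function that starts nonnegative and is not decreasing wherever it is negative
stays nonnegative. -/
lemma nonneg_of_frequently_slope_gt {f : ℝ → ℝ} {a b : ℝ} (hf : ContinuousOn f (Icc a b))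
    (ha : 0 ≤ f a)
    (hf' : ∀ x ∈ Ico a b, f x < 0 → ∀ r < 0, ∃ᶠ z in 𝓝[>] x, r < slope f x z) :
    ∀ x ∈ Icc a b, 0 ≤ f x := by
  intro x hx
  by_contra! hneg
  set S := Icc a x ∩ f ⁻¹' Ici 0
  have hfx : ContinuousOn f (Icc a x) := hf.mono (Icc_subset_Icc_right hx.2)
  have hSc : IsCompact S :=
    isCompact_Icc.of_isClosed_subset (hfx.preimage_isClosed_of_isClosed isClosed_Icc isClosed_Ici)
      inter_subset_left
  have hSne : S.Nonempty := ⟨a, ⟨le_rfl, hx.1⟩, ha⟩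
  obtain ⟨⟨hy1, hy2⟩, hy0⟩ := hSc.sSup_mem hSne
  set y := sSup S
  have hmax : ∀ z ∈ Ioc y x, f z < 0 := by
    intro z hz
    by_contra! h
    exact absurd (le_csSup hSc.bddAbove ⟨⟨hy1.trans hz.1.le, hz.2⟩, h⟩) (not_le.2 hz.1)
  have hyx : y < x := by
    refine lt_of_le_of_ne hy2 fun h => ?_
    rw [h] at hy0
    exact absurd hy0 (not_le.2 hneg)
  have hmono : ∀ z ∈ Ioc y x, f z ≤ f x := by
    intro z hz
    have key : ∀ ε > 0, -f x ≤ -f z + ε * (x - z) := by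
      intro ε hε
      refine image_le_of_liminf_slope_right_lt_deriv_boundary (f := fun x => -f x)
        (f' := fun _ => 0) (a := z) (b := x) (B := fun t => -f z + ε * (t - z))
        (B' := fun _ => ε) ?_ ?_ (by simp) ?_ (fun _ _ _ => hε) ⟨hz.2, le_rfl⟩
      · exact (hf.mono (Icc_subset_Icc (hy1.trans hz.1.le) hx.2)).neg
      · intro t ht r hr
        refine (hf' t ⟨(hy1.trans hz.1.le).trans ht.1, ht.2.trans_le hx.2⟩
          (hmax t ⟨hz.1.trans_le ht.1, ht.2.le⟩) (-r) (neg_neg_of_pos hr)).mono fun w hw => ?_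
        have : slope (fun x => -f x) t w = -slope f t w := by
          simp only [slope_def_field]; ring
        linarith
      · intro t
        simpa using (((hasDerivAt_id' t).sub_const z).const_mul ε).const_add (-f z)
    by_contra! h
    have hxz : 0 ≤ x - z := sub_nonneg.2 hz.2
    have h1 := key ((f z - f x) / (2 * (x - z + 1))) (by apply div_pos <;> linarith)
    have h2 : (f z - f x) / (2 * (x - z + 1)) * (x - z) ≤ (f z - f x) / 2 := by
      rw [div_mul_eq_mul_div, div_le_div_iff₀ (by linarith) (by norm_num)]
      nlinarith
    linarith
  have hlim : Tendsto f (𝓝[>] y) (𝓝 (f y)) := by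
    have h1 : ContinuousWithinAt f (Icc a x) y := hfx y ⟨hy1, hy2⟩
    refine h1.tendsto.mono_left ?_
    rw [← nhdsWithin_Ioc_eq_nhdsGT hyx]
    exact nhdsWithin_mono _ fun z hz => ⟨hy1.trans hz.1.le, hz.2⟩
  have hle : f y ≤ f x := by
    refine le_of_tendsto hlim ?_
    filter_upwards [Ioc_mem_nhdsGT hyx] with z hz using hmono z hz
  exact absurd (le_trans hy0 hle) (not_le.2 hneg)

lemma frequently_slope_gt_of_hasDerivAt {f : ℝ → ℝ} {f' x r : ℝ} (hf : HasDerivAt f f' x)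
    (hr : r < f') : ∃ᶠ z in 𝓝[>] x, r < slope f x z := by
  have h := (hasDerivAt_iff_tendsto_slope.1 hf).mono_left
    (nhdsWithin_mono x fun z (hz : z ∈ Ioi x) => (ne_of_gt hz))
  exact (h.eventually (lt_mem_nhds hr)).frequently

/-! ### Prüfer angles -/

/-- `θ` is a Prüfer angle (on a neighbourhood of `[0,1]`) of the solution of
`-y'' + q y = lam y`, `y 0 = 0`. -/
structure IsPrueferAngle (q : ℝ → ℝ) (lam : ℝ) (θ : ℝ → ℝ) : Prop where
  zero : θ 0 = 0
  hasDerivAt : ∀ x ∈ Ioo (-1 : ℝ) 2,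
    HasDerivAt θ (cos (θ x) ^ 2 + (lam - q x) * sin (θ x) ^ 2) x

namespace IsPrueferAngle

variable {q : ℝ → ℝ} {lam lam' : ℝ} {θ θ' : ℝ → ℝ}

lemma hasDerivAt_of_mem_Icc (h : IsPrueferAngle q lam θ) {x : ℝ} (hx : x ∈ Icc (0 : ℝ) 1) :
    HasDerivAt θ (cos (θ x) ^ 2 + (lam - q x) * sin (θ x) ^ 2) x :=
  h.hasDerivAt x ⟨by linarith [hx.1], by linarith [hx.2]⟩

lemma continuousOn (h : IsPrueferAngle q lam θ) : ContinuousOn θ (Icc 0 1) :=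
  fun _ hx => (h.hasDerivAt_of_mem_Icc hx).continuousAt.continuousWithinAt

lemma nonneg (h : IsPrueferAngle q lam θ) : ∀ x ∈ Icc (0 : ℝ) 1, 0 ≤ θ x := by
  intro x hx
  have := image_le_of_deriv_right_lt_deriv_boundary (f := fun x => -θ x) (B := fun _ => 0)
    (B' := fun _ => 0) h.continuousOn.neg
    (fun x hx => (h.hasDerivAt_of_mem_Icc (Ico_subset_Icc_self hx)).hasDerivWithinAt.fun_neg)
    (by simp [h.zero]) (fun x => hasDerivAt_const x 0)
    (fun x _ h0 => by
      have : θ x = 0 := by simpa using h0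
      simp [this]) hx
  simpa using this

/-- For an increasing potential, the frozen times belonging to a larger spectral parameter are
smaller. -/
lemma frozenTime_le (hqc : Continuous q) (hqm : Monotone q) (hq1 : q 1 < lam)
    (hlam : lam ≤ lam') (h : IsPrueferAngle q lam θ) (h' : IsPrueferAngle q lam' θ') :
    frozenTime lam' (θ' 1) (q 1) ≤ frozenTime lam (θ 1) (q 1) := by
  set M := 1 / (lam - q 1) with hM
  set Ψ : ℝ × ℝ × ℝ → ℝ := fun p =>
    exp (-M * p.1) * (frozenTime lam p.2.1 p.1 - frozenTime lam' p.2.2 p.1) with hΨ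
  have hΨc : ∀ p : ℝ × ℝ × ℝ, p.1 < lam → ContinuousAt Ψ p := by
    intro p hp
    have h1 : ContinuousAt (fun p : ℝ × ℝ × ℝ => frozenTime lam p.2.1 p.1) p :=
      ContinuousAt.comp (g := fun p : ℝ × ℝ => frozenTime lam p.1 p.2)
        (f := fun p : ℝ × ℝ × ℝ => (p.2.1, p.1)) (continuousAt_frozenTime hp) (by fun_prop)
    have h2 : ContinuousAt (fun p : ℝ × ℝ × ℝ => frozenTime lam' p.2.2 p.1) p :=
      ContinuousAt.comp (g := fun p : ℝ × ℝ => frozenTime lam' p.1 p.2)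
        (f := fun p : ℝ × ℝ × ℝ => (p.2.2, p.1))
        (continuousAt_frozenTime (hp.trans_le hlam)) (by fun_prop)
    exact ContinuousAt.mul (by fun_prop) (h1.sub h2)
  have hlt : ∀ x ∈ Icc (0 : ℝ) 1, q x < lam := fun x hx => (hqm hx.2).trans_lt hq1
  have hcurve : ∀ x ∈ Icc (0 : ℝ) 1, ContinuousAt (fun x => (q x, θ x, θ' x)) x := fun x hx =>
    hqc.continuousAt.prodMk ((h.hasDerivAt_of_mem_Icc hx).continuousAt.prodMk
      (h'.hasDerivAt_of_mem_Icc hx).continuousAt)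
  have hmain := nonneg_of_frequently_slope_gt (f := fun x => Ψ (q x, θ x, θ' x)) (a := 0) (b := 1)
    (fun x hx => (ContinuousAt.comp (f := fun x => (q x, θ x, θ' x)) (hΨc _ (hlt x hx))
      (hcurve x hx)).continuousWithinAt)
    (by simp [hΨ, h.zero, h'.zero, frozenTime]) ?_ 1 ⟨zero_le_one, le_rfl⟩
  · by_contra! hcon
    exact absurd hmain (not_le.2 (mul_neg_of_pos_of_neg (exp_pos _) (sub_neg.2 hcon)))
  intro x hx hneg r hr
  have hxI : x ∈ Icc (0 : ℝ) 1 := Ico_subset_Icc_self hx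
  have hfrozen : HasDerivAt (fun t => Ψ (q x, θ t, θ' t)) 0 x := by
    refine (((hasDerivAt_frozenTime_comp (hlt x hxI) (h.hasDerivAt_of_mem_Icc hxI)).fun_sub
      (hasDerivAt_frozenTime_comp ((hlt x hxI).trans_le hlam)
        (h'.hasDerivAt_of_mem_Icc hxI))).const_mul (exp (-M * q x))).congr_deriv (by simp)
  have hnear : ∀ᶠ p in 𝓝 (q x, θ x, θ' x), Ψ p < 0 := (hΨc _ (hlt x hxI)).eventually_lt_const hneg
  obtain ⟨δ, hδ, hball⟩ := Metric.eventually_nhds_iff_ball.1 hnear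
  have hev : ∀ᶠ z in 𝓝 x, (q z, θ z, θ' z) ∈ Metric.ball (q x, θ x, θ' x) δ :=
    (hcurve x hxI).eventually (Metric.ball_mem_nhds _ hδ)
  refine ((frequently_slope_gt_of_hasDerivAt hfrozen hr).and_eventually
    ((hev.filter_mono nhdsWithin_le_nhds).and (Ioc_mem_nhdsGT hx.2))).mono ?_
  rintro z ⟨hz, hzb, hzx⟩
  have hqz : q x ≤ q z := hqm hzx.1.le
  have hz1 : z ∈ Icc (0 : ℝ) 1 := ⟨hx.1.trans hzx.1.le, hzx.2⟩
  simp only [Metric.mem_ball, Prod.dist_eq, max_lt_iff] at hzb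
  have hstep : Ψ (q x, θ z, θ' z) ≤ Ψ (q z, θ z, θ' z) := by
    have hder : ∀ c ∈ Icc (q x) (q z), ∃ d, 0 ≤ d ∧
        HasDerivAt (fun c => Ψ (c, θ z, θ' z)) d c := by
      intro c hc
      have hc1 : c ≤ q 1 := hc.2.trans (hqm hz1.2)
      refine exists_hasDerivAt_weighted_frozenTime_sub (hc1.trans_lt hq1) hlam (h'.nonneg z hz1)
        (one_div_le_one_div_of_le (sub_pos.2 hq1) (by linarith)) (hball (c, θ z, θ' z) ?_).le
      simp only [Metric.mem_ball, Prod.dist_eq, max_lt_iff]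
      refine ⟨?_, hzb.2⟩
      have := hzb.1
      rw [Real.dist_eq, abs_lt] at this ⊢
      constructor <;> linarith [hc.1, hc.2]
    choose! d hd0 hd using hder
    exact monotoneOn_of_hasDerivWithinAt_nonneg (convex_Icc _ _)
      (fun c hc => (hd c hc).continuousAt.continuousWithinAt)
      (fun c hc => (hd c (interior_subset hc)).hasDerivWithinAt)
      (fun c hc => hd0 c (interior_subset hc)) ⟨le_rfl, hqz⟩ ⟨hqz, le_rfl⟩ hqz
  refine hz.trans_le ?_
  rw [slope_def_field, slope_def_field]
  exact div_le_div_of_nonneg_right (by linarith) (sub_pos.2 hzx.1).le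

/-! ### Dependence on the spectral parameter -/

lemma abs_sin_sq_sub_sin_sq_le (a b : ℝ) : |sin a ^ 2 - sin b ^ 2| ≤ 2 * |a - b| := by
  have e : sin a ^ 2 - sin b ^ 2 = (sin a + sin b) * (sin a - sin b) := by ring
  rw [e, abs_mul]
  refine mul_le_mul ?_ (abs_sin_sub_sin_le a b) (abs_nonneg _) zero_le_two
  exact (abs_add_le _ _).trans (by linarith [abs_sin_le_one a, abs_sin_le_one b])

lemma hasDerivAt_sub (h : IsPrueferAngle q lam θ) (h' : IsPrueferAngle q lam' θ') {x : ℝ}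
    (hx : x ∈ Icc (0 : ℝ) 1) :
    HasDerivAt (fun x => θ' x - θ x) ((lam - q x - 1) * (sin (θ' x) ^ 2 - sin (θ x) ^ 2) +
      (lam' - lam) * sin (θ' x) ^ 2) x := by
  refine ((h'.hasDerivAt_of_mem_Icc hx).fun_sub (h.hasDerivAt_of_mem_Icc hx)).congr_deriv ?_
  rw [cos_sq', cos_sq']
  ring

lemma exists_bound (hqc : Continuous q) (lam : ℝ) :
    ∃ K : ℝ, 0 < K ∧ ∀ x ∈ Icc (0 : ℝ) 1, ∀ a b : ℝ,
      |(lam - q x - 1) * (sin a ^ 2 - sin b ^ 2)| ≤ K * |a - b| := by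
  obtain ⟨C, hC⟩ := isCompact_Icc.exists_bound_of_continuousOn (s := Icc (0 : ℝ) 1)
    (f := fun x => lam - q x - 1) (by fun_prop)
  have hC0 : 0 ≤ C := (norm_nonneg _).trans (hC 0 ⟨le_rfl, zero_le_one⟩)
  refine ⟨2 * C + 1, by linarith, fun x hx a b => ?_⟩
  rw [abs_mul]
  have h1 : |lam - q x - 1| ≤ C := hC x hx
  have h2 := abs_sin_sq_sub_sin_sq_le a b
  have := mul_le_mul h1 h2 (abs_nonneg _) hC0
  nlinarith [abs_nonneg (a - b)]

lemma le_of_le (hqc : Continuous q) (hlam : lam ≤ lam') (h : IsPrueferAngle q lam θ)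
    (h' : IsPrueferAngle q lam' θ') : ∀ x ∈ Icc (0 : ℝ) 1, θ x ≤ θ' x := by
  obtain ⟨K, hK, hb⟩ := exists_bound hqc lam
  have hder : ∀ x ∈ Icc (0 : ℝ) 1, HasDerivAt (fun x => exp (-K * x) * (θ' x - θ x)) _ x :=
    fun x hx => ((hasDerivAt_id' x).const_mul (-K)).exp.fun_mul (h.hasDerivAt_sub h' hx)
  have := nonneg_of_frequently_slope_gt
    (fun x hx => (hder x hx).continuousAt.continuousWithinAt) (by simp [h.zero, h'.zero]) ?_
  · intro x hx
    exact sub_nonneg.1 (nonneg_of_mul_nonneg_right (this x hx) (exp_pos _))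
  intro x hx hneg r hr
  have hxI := Ico_subset_Icc_self hx
  refine frequently_slope_gt_of_hasDerivAt (hder x hxI) (hr.trans_le ?_)
  have hδ : θ' x - θ x < 0 := by
    by_contra! hcon
    exact absurd hneg (not_lt.2 (mul_nonneg (exp_pos _).le hcon))
  have h1 := hb x hxI (θ' x) (θ x)
  rw [abs_of_neg hδ] at h1
  have h2 := (abs_le.1 h1).1
  have h3 : 0 ≤ (lam' - lam) * sin (θ' x) ^ 2 := mul_nonneg (sub_nonneg.2 hlam) (sq_nonneg _)
  have : 0 ≤ exp (-K * x) * (-K * (θ' x - θ x) + ((lam - q x - 1) *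
      (sin (θ' x) ^ 2 - sin (θ x) ^ 2) + (lam' - lam) * sin (θ' x) ^ 2)) :=
    mul_nonneg (exp_pos _).le (by linarith)
  linarith

lemma lt_of_lt (hqc : Continuous q) (hlam : lam < lam') (h : IsPrueferAngle q lam θ)
    (h' : IsPrueferAngle q lam' θ') : θ 1 < θ' 1 := by
  have hle := le_of_le hqc hlam.le h h'
  refine lt_of_le_of_ne (hle 1 ⟨zero_le_one, le_rfl⟩) fun h1 => ?_
  obtain ⟨K, hK, hb⟩ := exists_bound hqc lam
  have hder : ∀ x ∈ Icc (0 : ℝ) 1, HasDerivAt (fun x => exp (K * x) * (θ' x - θ x)) _ x :=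
    fun x hx => ((hasDerivAt_id' x).const_mul K).exp.fun_mul (h.hasDerivAt_sub h' hx)
  have hmono := monotoneOn_of_hasDerivWithinAt_nonneg (convex_Icc (0 : ℝ) 1)
    (fun x hx => (hder x hx).continuousAt.continuousWithinAt)
    (fun x hx => (hder x (interior_subset hx)).hasDerivWithinAt) (fun x hx => by
      have hxI := interior_subset hx
      have hδ : 0 ≤ θ' x - θ x := sub_nonneg.2 (hle x hxI)
      have h1 := hb x hxI (θ' x) (θ x)
      rw [abs_of_nonneg hδ] at h1
      have h2 := (abs_le.1 h1).1
      have h3 : 0 ≤ (lam' - lam) * sin (θ' x) ^ 2 :=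
        mul_nonneg (sub_nonneg.2 hlam.le) (sq_nonneg _)
      have : 0 ≤ exp (K * x) * (K * (θ' x - θ x) + ((lam - q x - 1) *
          (sin (θ' x) ^ 2 - sin (θ x) ^ 2) + (lam' - lam) * sin (θ' x) ^ 2)) :=
        mul_nonneg (exp_pos _).le (by linarith)
      linarith)
  have heq : ∀ x ∈ Icc (0 : ℝ) 1, θ' x = θ x := by
    intro x hx
    have h2 := hmono hx ⟨zero_le_one, le_rfl⟩ hx.2
    simp only [h1, sub_self, mul_zero] at h2
    have := nonpos_of_mul_nonpos_right h2 (exp_pos _)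
    linarith [hle x hx]
  have hsin : ∀ x ∈ Ioo (0 : ℝ) 1, sin (θ' x) = 0 := by
    intro x hx
    have hxI := Ioo_subset_Icc_self hx
    have hloc : (fun x => θ' x - θ x) =ᶠ[𝓝 x] fun _ => 0 := by
      filter_upwards [Icc_mem_nhds hx.1 hx.2] with z hz
      rw [heq z hz, sub_self]
    have h2 := ((h.hasDerivAt_sub h' hxI).congr_of_eventuallyEq hloc.symm).unique
      (hasDerivAt_const x (0 : ℝ))
    rw [heq x hxI, sub_self, mul_zero, zero_add] at h2
    rw [heq x hxI]
    exact pow_eq_zero_iff two_ne_zero |>.1 ((mul_eq_zero.1 h2).resolve_left (sub_pos.2 hlam).ne')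
  have h0 : HasDerivAt (fun x => sin (θ' x)) 1 0 := by
    simpa [h'.zero] using (h'.hasDerivAt_of_mem_Icc ⟨le_rfl, zero_le_one⟩).sin
  have hev := (h0.eventually_ne (c := 0) one_ne_zero).filter_mono
    (nhdsWithin_mono 0 fun z (hz : z ∈ Ioi (0 : ℝ)) => (ne_of_gt hz))
  obtain ⟨z, hz1, hz2⟩ := (hev.and (Ioo_mem_nhdsGT zero_lt_one)).exists
  exact hz1 (hsin z hz2)

end IsPrueferAngle

/-! ### Existence of Prüfer angles and their range -/

lemma exists_isPrueferAngle {q : ℝ → ℝ} (hqc : Continuous q) (lam : ℝ) :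
    ∃ θ, IsPrueferAngle q lam θ := by
  obtain ⟨C, hC⟩ := isCompact_Icc.exists_bound_of_continuousOn (s := Icc (-1 : ℝ) 2)
    (f := fun x => lam - q x) (by fun_prop)
  obtain ⟨C', hC'⟩ := isCompact_Icc.exists_bound_of_continuousOn (s := Icc (-1 : ℝ) 2)
    (f := fun x => lam - q x - 1) (by fun_prop)
  have hmem : (0 : ℝ) ∈ Icc (-1 : ℝ) 2 := by norm_num
  lift C to NNReal using (norm_nonneg _).trans (hC 0 hmem)
  lift C' to NNReal using (norm_nonneg _).trans (hC' 0 hmem)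
  have hpl : IsPicardLindelof (fun t u => cos u ^ 2 + (lam - q t) * sin u ^ 2)
      (tmin := -1) (tmax := 2) ⟨0, hmem⟩ (0 : ℝ) (2 * (1 + C)) 0 (1 + C) (2 * C') := by
    refine ⟨fun t ht => ?_, fun u _ => by fun_prop, fun t ht u _ => ?_, ?_⟩
    · refine LipschitzOnWith.of_dist_le_mul fun a _ b _ => ?_
      rw [Real.dist_eq, Real.dist_eq]
      have e : cos a ^ 2 + (lam - q t) * sin a ^ 2 - (cos b ^ 2 + (lam - q t) * sin b ^ 2) =
          (lam - q t - 1) * (sin a ^ 2 - sin b ^ 2) := by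
        rw [cos_sq', cos_sq']; ring
      rw [e, abs_mul]
      refine (mul_le_mul (hC' t ht) (IsPrueferAngle.abs_sin_sq_sub_sin_sq_le a b) (abs_nonneg _)
        C'.coe_nonneg).trans_eq ?_
      push_cast
      ring
    · have h1 : |lam - q t| ≤ C := hC t ht
      have h2 : |(lam - q t) * sin u ^ 2| ≤ C := by
        rw [abs_mul, abs_of_nonneg (sq_nonneg (sin u))]
        exact (mul_le_of_le_one_right (abs_nonneg _) (sin_sq_le_one u)).trans h1
      rw [Real.norm_eq_abs]
      refine (abs_add_le _ _).trans ?_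
      rw [abs_of_nonneg (sq_nonneg (cos u))]
      push_cast
      linarith [cos_sq_le_one u]
    · push_cast
      rw [sub_zero, sub_zero, zero_sub, neg_neg, max_eq_left (by norm_num)]
      linarith
  obtain ⟨θ, h0, hθ⟩ := hpl.exists_eq_forall_mem_Icc_hasDerivWithinAt₀
  exact ⟨θ, h0, fun x hx =>
    (hθ x (Ioo_subset_Icc_self hx)).hasDerivAt (Icc_mem_nhds hx.1 hx.2)⟩

namespace IsPrueferAngle

variable {q : ℝ → ℝ} {lam lam' : ℝ} {θ θ' : ℝ → ℝ}

lemma exists_abs_sub_le_gronwallBound (hqc : Continuous q) (h : IsPrueferAngle q lam θ) :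
    ∃ K : ℝ, ∀ lam' θ', IsPrueferAngle q lam' θ' →
      |θ' 1 - θ 1| ≤ gronwallBound 0 K |lam' - lam| (1 - 0) := by
  obtain ⟨K, hK, hb⟩ := exists_bound hqc lam
  refine ⟨K, fun lam' θ' h' => ?_⟩
  refine norm_le_gronwallBound_of_norm_deriv_right_le (f := fun x => θ' x - θ x)
    (fun x hx => (h.hasDerivAt_sub h' hx).continuousAt.continuousWithinAt)
    (fun x hx => (h.hasDerivAt_sub h' (Ico_subset_Icc_self hx)).hasDerivWithinAt)
    (by simp [h.zero, h'.zero]) (fun x hx => ?_) 1 ⟨zero_le_one, le_rfl⟩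
  refine (norm_add_le _ _).trans (add_le_add (hb x (Ico_subset_Icc_self hx) _ _) ?_)
  rw [norm_mul, Real.norm_eq_abs, Real.norm_eq_abs, abs_of_nonneg (sq_nonneg (sin (θ' x)))]
  exact mul_le_of_le_one_right (abs_nonneg _) (sin_sq_le_one _)

lemma continuous_apply_one (hqc : Continuous q) {Θ : ℝ → ℝ → ℝ}
    (hΘ : ∀ lam, IsPrueferAngle q lam (Θ lam)) : Continuous fun lam => Θ lam 1 := by
  refine continuous_iff_continuousAt.2 fun lam => ?_
  obtain ⟨K, hK⟩ := exists_abs_sub_le_gronwallBound hqc (hΘ lam)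
  have hlim : Tendsto (fun lam' : ℝ => gronwallBound 0 K |lam' - lam| (1 - 0)) (𝓝 lam) (𝓝 0) := by
    have hc : Continuous fun lam' : ℝ => gronwallBound 0 K |lam' - lam| (1 - 0) :=
      (gronwallBound_continuous_ε 0 K (1 - 0)).comp (by fun_prop)
    simpa [gronwallBound_ε0_δ0] using hc.tendsto lam
  exact tendsto_iff_dist_tendsto_zero.2 (squeeze_zero (fun _ => dist_nonneg)
    (fun lam' => hK lam' _ (hΘ lam')) hlim)

lemma lt_pi_div_two (h : IsPrueferAngle q lam θ) (hq : ∀ x ∈ Icc (0 : ℝ) 1, lam ≤ q x) :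
    θ 1 < π / 2 := by
  refine lt_of_le_of_lt ?_ (arctan_lt_pi_div_two (2 * 1))
  refine image_le_of_deriv_right_lt_deriv_boundary (B := fun x => arctan (2 * x))
    h.continuousOn
    (fun x hx => (h.hasDerivAt_of_mem_Icc (Ico_subset_Icc_self hx)).hasDerivWithinAt)
    (by simp [h.zero]) (fun x => ((hasDerivAt_id' x).const_mul 2).arctan)
    (fun x hx hθ => ?_) ⟨zero_le_one, le_rfl⟩
  have h1 : (lam - q x) * sin (θ x) ^ 2 ≤ 0 :=
    mul_nonpos_of_nonpos_of_nonneg (sub_nonpos.2 (hq x (Ico_subset_Icc_self hx))) (sq_nonneg _)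
  have h2 : cos (θ x) ^ 2 = 1 / (1 + (2 * x) ^ 2) := by rw [hθ, cos_sq_arctan]
  have h3 : 0 < 1 / (1 + (2 * x) ^ 2) := by positivity
  linarith

lemma sub_pi_div_two_le {s : ℝ} (hs : 0 < s) (h : IsPrueferAngle q (s ^ 2) θ)
    (hq : ∀ x ∈ Icc (0 : ℝ) 1, q x ≤ 0) : s - π / 2 ≤ θ 1 := by
  have hder : ∀ x ∈ Icc (0 : ℝ) 1, HasDerivAt (fun x => scaleAngle s (θ x) - s * x) _ x :=
    fun x hx => (HasDerivAt.comp x (hasDerivAt_scaleAngle_right hs (θ x))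
      (h.hasDerivAt_of_mem_Icc hx)).fun_sub ((hasDerivAt_id' x).const_mul s)
  have hmono := monotoneOn_of_hasDerivWithinAt_nonneg (convex_Icc (0 : ℝ) 1)
    (fun x hx => (hder x hx).continuousAt.continuousWithinAt)
    (fun x hx => (hder x (interior_subset hx)).hasDerivWithinAt) (fun x hx => by
      have hC := cos_sq_add_mul_sin_sq_pos (pow_pos hs 2) (θ x)
      have h1 : q x * sin (θ x) ^ 2 ≤ 0 :=
        mul_nonpos_of_nonpos_of_nonneg (hq x (interior_subset hx)) (sq_nonneg _)
      rw [sub_nonneg, mul_one, div_mul_eq_mul_div, le_div_iff₀ hC]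
      exact mul_le_mul_of_nonneg_left (by linarith) hs.le)
  have := hmono ⟨le_rfl, zero_le_one⟩ ⟨zero_le_one, le_rfl⟩ zero_le_one
  simp only [h.zero, scaleAngle_zero, mul_zero, mul_one] at this
  linarith [scaleAngle_le s (θ 1)]

/-! ### Eigenvalues in terms of Prüfer angles -/

lemma exists_amplitude (hqc : Continuous q) (h : IsPrueferAngle q lam θ) :
    ∃ r : ℝ → ℝ, ∀ x ∈ Icc (0 : ℝ) 1, 0 < r x ∧
      HasDerivAt r (r x * ((1 + q x - lam) * (sin (θ x) * cos (θ x)))) x := by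
  have hg : ContinuousOn (fun x => (1 + q x - lam) * (sin (θ x) * cos (θ x))) (Ioo (-1) 2) := by
    have hθ : ContinuousOn θ (Ioo (-1) 2) :=
      fun x hx => (h.hasDerivAt x hx).continuousAt.continuousWithinAt
    exact ContinuousOn.mul (by fun_prop)
      ((continuous_sin.comp_continuousOn hθ).mul (continuous_cos.comp_continuousOn hθ))
  refine ⟨fun x => exp (∫ t in (0 : ℝ)..x, (1 + q t - lam) * (sin (θ t) * cos (θ t))),
    fun x hx => ⟨exp_pos _, HasDerivAt.exp ?_⟩⟩
  have hxI : x ∈ Ioo (-1 : ℝ) 2 := ⟨by linarith [hx.1], by linarith [hx.2]⟩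
  refine intervalIntegral.integral_hasDerivAt_right
    (ContinuousOn.intervalIntegrable (hg.mono ?_))
    (hg.stronglyMeasurableAtFilter isOpen_Ioo x hxI) (hg.continuousAt (isOpen_Ioo.mem_nhds hxI))
  rw [uIcc_of_le hx.1]
  exact fun t ht => ⟨by linarith [ht.1], by linarith [ht.2, hx.2]⟩

lemma isDirichletNeumannEigenvalue_iff (hqc : Continuous q) (h : IsPrueferAngle q lam θ) :
    IsDirichletNeumannEigenvalue q lam ↔ cos (θ 1) = 0 := by
  obtain ⟨r, hr⟩ := h.exists_amplitude hqc
  constructor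
  · rintro ⟨y, y', hy, hy', ⟨x₀, hx₀, hne⟩, hy0, hy1⟩
    have hw : ∀ x ∈ Icc (0 : ℝ) 1,
        HasDerivAt (fun x => (y x * cos (θ x) - y' x * sin (θ x)) * r x) 0 x := by
      intro x hx
      have hθ := h.hasDerivAt_of_mem_Icc hx
      refine ((((hy x hx).fun_mul hθ.cos).fun_sub ((hy' x hx).fun_mul hθ.sin)).fun_mul
        (hr x hx).2).congr_deriv ?_
      have h1 := sin_sq_add_cos_sq (θ x)
      linear_combination (- r x * (y' x * cos (θ x))) * h1 +
        (r x * y x * sin (θ x) * (q x - lam)) * h1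
    have hw0 : ∀ x ∈ Icc (0 : ℝ) 1, y x * cos (θ x) = y' x * sin (θ x) := by
      intro x hx
      have := constant_of_has_deriv_right_zero
        (fun x hx => (hw x hx).continuousAt.continuousWithinAt)
        (fun x hx => (hw x (Ico_subset_Icc_self hx)).hasDerivWithinAt) x hx
      simp only [hy0, h.zero, zero_mul, sin_zero, mul_zero, sub_zero] at this
      exact sub_eq_zero.1 ((mul_eq_zero.1 this).resolve_right (hr x hx).1.ne')
    have hv : ∀ x ∈ Icc (0 : ℝ) 1,
        HasDerivAt (fun x => (y x * sin (θ x) + y' x * cos (θ x)) / r x) 0 x := by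
      intro x hx
      have hθ := h.hasDerivAt_of_mem_Icc hx
      have hr0 := (hr x hx).1.ne'
      refine ((((hy x hx).fun_mul hθ.sin).fun_add ((hy' x hx).fun_mul hθ.cos)).fun_div
        (hr x hx).2 hr0).congr_deriv ?_
      have h1 := sin_sq_add_cos_sq (θ x)
      have h2 := hw0 x hx
      rw [div_eq_zero_iff]
      left
      linear_combination (r x * (1 + q x - lam) * (cos (θ x) ^ 2 - sin (θ x) ^ 2)) * h2 -
        r x * y' x * sin (θ x) * h1 + r x * y x * cos (θ x) * (lam - q x) * h1
    by_contra hcos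
    have hy1' : y 1 = 0 := by
      have := hw0 1 ⟨zero_le_one, le_rfl⟩
      rw [hy1, zero_mul] at this
      exact (mul_eq_zero.1 this).resolve_right hcos
    have hv0 : ∀ x ∈ Icc (0 : ℝ) 1, y x * sin (θ x) + y' x * cos (θ x) = 0 := by
      have hconst := constant_of_has_deriv_right_zero
        (fun x hx => (hv x hx).continuousAt.continuousWithinAt)
        (fun x hx => (hv x (Ico_subset_Icc_self hx)).hasDerivWithinAt)
      intro x hx
      have := (hconst x hx).trans (hconst 1 ⟨zero_le_one, le_rfl⟩).symm
      simp only [hy1, hy1', zero_mul, add_zero, zero_div] at this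
      exact (div_eq_zero_iff.1 this).resolve_right (hr x hx).1.ne'
    refine hne ?_
    linear_combination sin (θ x₀) * hv0 x₀ hx₀ + cos (θ x₀) * hw0 x₀ hx₀ -
      y x₀ * sin_sq_add_cos_sq (θ x₀)
  · intro hcos
    have h1 : (1 : ℝ) ∈ Icc (0 : ℝ) 1 := ⟨zero_le_one, le_rfl⟩
    refine ⟨fun x => r x * sin (θ x), fun x => r x * cos (θ x), fun x hx => ?_, fun x hx => ?_,
      ⟨1, h1, ?_⟩, by simp [h.zero], by simp [hcos]⟩
    · refine ((hr x hx).2.fun_mul (h.hasDerivAt_of_mem_Icc hx).sin).congr_deriv ?_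
      linear_combination r x * cos (θ x) * sin_sq_add_cos_sq (θ x)
    · refine ((hr x hx).2.fun_mul (h.hasDerivAt_of_mem_Icc hx).cos).congr_deriv ?_
      linear_combination (r x * sin (θ x) * (q x - lam)) * sin_sq_add_cos_sq (θ x)
    · refine mul_ne_zero (hr 1 h1).1.ne' fun hsin => ?_
      have := sin_sq_add_cos_sq (θ 1)
      simp [hsin, hcos] at this

end IsPrueferAngle

lemma cos_two_mul_sub_one_mul_pi_div_two (n : ℕ+) : cos ((2 * (n : ℝ) - 1) * π / 2) = 0 := by
  refine cos_eq_zero_iff.2 ⟨(n : ℤ) - 1, ?_⟩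
  push_cast
  ring

/-- The Prüfer angle of the `n`-th eigenfunction at `1` is `(2 n - 1) π / 2`. -/
lemma IsPrueferAngle.apply_one_eq {q : ℝ → ℝ} (hqc : Continuous q) (hqm : Monotone q)
    (hq1 : q 1 ≤ 0) {Θ : ℝ → ℝ → ℝ} (hΘ : ∀ lam, IsPrueferAngle q lam (Θ lam)) {μ : ℕ+ → ℝ}
    (hμ : StrictMono μ) (hμ_eig : ∀ n, IsDirichletNeumannEigenvalue q (μ n))
    (hμ_all : ∀ lam, IsDirichletNeumannEigenvalue q lam → ∃ n, μ n = lam) (n : ℕ+) :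
    Θ (μ n) 1 = (2 * (n : ℝ) - 1) * π / 2 := by
  have hmono : StrictMono fun lam => Θ lam 1 :=
    fun lam lam' hlt => lt_of_lt hqc hlt (hΘ lam) (hΘ lam')
  have hex : ∀ n : ℕ+, ∃ lam, Θ lam 1 = (2 * (n : ℝ) - 1) * π / 2 := by
    intro n
    have hn : (1 : ℝ) ≤ n := by exact_mod_cast (one_le : 1 ≤ n)
    refine mem_range_of_exists_le_of_exists_ge (continuous_apply_one hqc hΘ)
      ⟨q 0, ((hΘ (q 0)).lt_pi_div_two fun x hx => hqm hx.1).le.trans ?_⟩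
      ⟨(n * π) ^ 2, le_trans ?_ ((hΘ _).sub_pi_div_two_le (by positivity)
        fun x hx => (hqm hx.2).trans hq1)⟩
    · nlinarith [pi_pos]
    · linarith
  choose ν hν using hex
  have hν_mono : StrictMono ν := by
    intro m n hmn
    refine hmono.lt_iff_lt.1 ?_
    have : (m : ℝ) < n := by exact_mod_cast hmn
    simp only [hν]
    nlinarith [pi_pos]
  have hrange : range μ = range ν := by
    refine Subset.antisymm ?_ ?_
    · rintro _ ⟨n, rfl⟩
      obtain ⟨k, hk⟩ := cos_eq_zero_iff.1
        (((hΘ (μ n)).isDirichletNeumannEigenvalue_iff hqc).1 (hμ_eig n))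
      have h0 := (hΘ (μ n)).nonneg 1 ⟨zero_le_one, le_rfl⟩
      have hk0 : 0 ≤ k := by
        by_contra! hneg
        have : (k : ℝ) ≤ -1 := by exact_mod_cast Int.le_sub_one_of_lt hneg
        nlinarith [pi_pos]
      lift k to ℕ using hk0
      refine ⟨k.succPNat, hmono.injective ?_⟩
      simp only [hν, hk]
      push_cast [Nat.succPNat_coe]
      ring
    · rintro _ ⟨n, rfl⟩
      refine hμ_all _ (((hΘ (ν n)).isDirichletNeumannEigenvalue_iff hqc).2 ?_)
      rw [hν, cos_two_mul_sub_one_mul_pi_div_two]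
  rw [(hμ.range_inj hν_mono).1 hrange, hν]

lemma IsDirichletNeumannEigenvalue.congr {q q' : ℝ → ℝ} {lam : ℝ} (hq : EqOn q q' (Icc 0 1))
    (h : IsDirichletNeumannEigenvalue q lam) : IsDirichletNeumannEigenvalue q' lam := by
  obtain ⟨y, y', hy, hy', h⟩ := h
  exact ⟨y, y', hy, fun x hx => hq hx ▸ hy' x hx, h⟩

/-- The ratio bound for an increasing nonpositive potential defined on the whole line. -/
lemma eigenvalue_ratio_le_of_monotone {q : ℝ → ℝ} (hqc : Continuous q) (hqm : Monotone q)
    (hq1 : q 1 ≤ 0) {μ : ℕ+ → ℝ} (hμ : StrictMono μ)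
    (hμ_eig : ∀ n, IsDirichletNeumannEigenvalue q (μ n))
    (hμ_all : ∀ lam, IsDirichletNeumannEigenvalue q lam → ∃ n, μ n = lam) {m n : ℕ+}
    (hmn : μ m < μ n) (hm : -2 * q 0 ≤ μ m) :
    (2 * (n : ℝ) - 1) ^ 2 / (2 * (m : ℝ) - 1) ^ 2 ≤ μ n / μ m := by
  choose Θ hΘ using exists_isPrueferAngle hqc
  have hangle := IsPrueferAngle.apply_one_eq hqc hqm hq1 hΘ hμ hμ_eig hμ_all
  have hm1 : (1 : ℝ) ≤ m := by exact_mod_cast (one_le : 1 ≤ m)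
  have hn1 : (1 : ℝ) ≤ n := by exact_mod_cast (one_le : 1 ≤ n)
  have hpos : 0 < μ m := by
    by_contra! hneg
    have := (hΘ (μ m)).lt_pi_div_two fun x hx => by linarith [hqm hx.1]
    rw [hangle] at this
    nlinarith [pi_pos]
  have hs : 0 < √(μ m - q 1) := sqrt_pos.2 (by linarith)
  have hs' : 0 < √(μ n - q 1) := sqrt_pos.2 (by linarith)
  have htime := IsPrueferAngle.frozenTime_le hqc hqm (by linarith) hmn.le (hΘ (μ m)) (hΘ (μ n))
  rw [frozenTime, frozenTime, hangle, hangle,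
    scaleAngle_of_cos_eq_zero (cos_two_mul_sub_one_mul_pi_div_two n),
    scaleAngle_of_cos_eq_zero (cos_two_mul_sub_one_mul_pi_div_two m),
    div_le_div_iff₀ hs' hs] at htime
  have hlin : (2 * (n : ℝ) - 1) * √(μ m - q 1) ≤ (2 * (m : ℝ) - 1) * √(μ n - q 1) := by
    nlinarith [pi_pos]
  have hsq := pow_le_pow_left₀ (mul_nonneg (by linarith) hs.le) hlin 2
  rw [mul_pow, mul_pow, sq_sqrt (by linarith), sq_sqrt (by linarith)] at hsq
  have hle : (2 * (n : ℝ) - 1) ^ 2 / (2 * (m : ℝ) - 1) ^ 2 ≤ (μ n - q 1) / (μ m - q 1) := by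
    rw [div_le_div_iff₀ (pow_pos (by linarith) 2) (by linarith)]
    linarith
  refine hle.trans ?_
  rw [div_le_div_iff₀ (by linarith) hpos]
  nlinarith

end Pruefer

/-!
**Statement 6.**  Let `q : [0,1] → ℝ` be continuous, nonpositive and increasing on
`[0,1]`, and set `q₋ = min {q x : x ∈ [0,1]}`.  Let `λ₁ < λ₂ < ⋯` enumerate the
eigenvalues of the Dirichlet–Neumann problem `−y'' + q y = λ y` on `[0,1]`,
`y 0 = y' 1 = 0`.  Then for any indices `n, m` with `λ_n > λ_m ≥ −2 q₋`, one has
`λ_n / λ_m ≥ (2n−1)² / (2m−1)²`.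
-/
theorem dirichlet_neumann_eigenvalue_ratio_lower_bound
    (q : ℝ → ℝ)
    (hq_cont : ContinuousOn q (Set.Icc 0 1))
    (hq_nonpos : ∀ x ∈ Set.Icc (0 : ℝ) 1, q x ≤ 0)
    (hq_inc : MonotoneOn q (Set.Icc 0 1))
    (qmin : ℝ) (hqmin : IsLeast (q '' Set.Icc 0 1) qmin)
    -- `μ n` is the `n`-th Dirichlet–Neumann eigenvalue: `μ` is the strictly
    -- increasing enumeration of the whole spectrum
    (μ : ℕ+ → ℝ) (hμ_mono : StrictMono μ)
    (hμ_eig : ∀ n : ℕ+, IsDirichletNeumannEigenvalue q (μ n))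
    (hμ_all : ∀ lam : ℝ, IsDirichletNeumannEigenvalue q lam → ∃ n : ℕ+, μ n = lam) :
    ∀ n m : ℕ+, μ m < μ n → -2 * qmin ≤ μ m →
      (2 * (n : ℝ) - 1) ^ 2 / (2 * (m : ℝ) - 1) ^ 2 ≤ μ n / μ m := by
  have h0 : (0 : ℝ) ∈ Set.Icc (0 : ℝ) 1 := ⟨le_rfl, zero_le_one⟩
  have h1 : (1 : ℝ) ∈ Set.Icc (0 : ℝ) 1 := ⟨zero_le_one, le_rfl⟩
  set Q : ℝ → ℝ := Set.IccExtend zero_le_one ((Set.Icc 0 1).domRestrict q)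
  have hQ : Set.EqOn q Q (Set.Icc 0 1) := fun x hx =>
    (Set.IccExtend_of_mem zero_le_one ((Set.Icc 0 1).domRestrict q) hx).symm
  have hQc : Continuous Q := hq_cont.domRestrict.Icc_extend'
  have hQm : Monotone Q := Monotone.IccExtend (f := (Set.Icc 0 1).domRestrict q) zero_le_one
    fun x y hxy => hq_inc x.2 y.2 hxy
  intro n m hmn hm
  refine eigenvalue_ratio_le_of_monotone hQc hQm (hQ h1 ▸ hq_nonpos 1 h1) hμ_mono
    (fun n => (hμ_eig n).congr hQ) (fun lam h => hμ_all lam (h.congr hQ.symm)) hmn ?_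
  have hmin : qmin ≤ q 0 := hqmin.2 ⟨0, h0, rfl⟩
  rw [← hQ h0]
  linarith
end
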